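/- arXiv:2508.02019 — 2 statements merged into one kernel-verified Lean document; each statement's English description precedes it below -/
import Mathlib

section
/- Let (H, α, β, ·, Δ, ε) be a Hopf algebroid over R, F a twistor of H, and H_F = (H, α_F, β_F, ·, Δ_F, ε) the twisted Hopf algebroid over R_F with Δ_F(x) := (F♯)^{−1}(Δ(x)·F). For every integer k ≥ 2 and every h ∈ H, one has F♯(Δ_F^{k−1}(h)) = (Δ^{k−1}h) · E_k in H^{⊗_R k}, where E_k := F♯(1⊗_{R_F}⋯⊗_{R_F}1) (k tensor factors equal to 1) and (Δ^{k−1}h)·E_k denotes the insertion action of Δ^{k−1}(h) on E_k. -/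
/-! # Preliminaries: Hopf algebroids in the sense of Xu

We fix a field `K` of characteristic zero, an associative unital `K`-algebra `R` and an
associative unital `K`-algebra `H`.  We construct the `n`-fold tensor powers
`H^{⊗_K n}` of `H` over `K` and, given source and target maps `α, β : R → H`, the
quotients `H^{⊗_R n}` of `H^{⊗_K n}` by the right ideal `I_n` generated by the elements
`1 ⊗ ⋯ ⊗ β(r) ⊗ 1 ⊗ ⋯ ⊗ 1 − 1 ⊗ ⋯ ⊗ 1 ⊗ α(r) ⊗ ⋯ ⊗ 1`.

A Hopf algebroid is then given by the data `(H, α, β, ·, Δ, ε)` subject to the axioms of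
Xu; the iterated coproducts `Δⁿ = (Δ^{n−1} ⊗_R id) ∘ Δ` are part of the data, uniquely
characterized by their recursion.  All axioms involving maps induced on the quotients
`H^{⊗_R n}` are stated equivalently in terms of (arbitrary) lifts along the quotient
maps and (arbitrary) presentations of elements as sums of pure tensors. -/

noncomputable section

open scoped TensorProduct

universe u

variable (K : Type u) [Field K] [CharZero K]

/-- A bundled associative unital `K`-algebra. -/
structure BAlg : Type (u + 1) where
  carrier : Type u
  [isRing : Ring carrier]
  [isAlgebra : Algebra K carrier]

attribute [instance] BAlg.isRing BAlg.isAlgebra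

instance : CoeSort (BAlg K) (Type u) := ⟨BAlg.carrier⟩

variable (H : Type u) [Ring H] [Algebra K H]

/-- The `n`-fold tensor power `H^{⊗_K n}` of `H` over `K` (with `H^{⊗_K 0} = K` and
`H^{⊗_K 1} = H`), as a bundled `K`-algebra. -/
def TPa : ℕ → BAlg K
  | 0 => ⟨K⟩
  | 1 => ⟨H⟩
  | (n + 2) => ⟨(TPa (n + 1)) ⊗[K] H⟩

/-- The `n`-fold tensor power `H^{⊗_K n}`. -/
abbrev TP (n : ℕ) : Type u := TPa K H n

/-- The element of `H^{⊗_K n}` with `h` in slot `i` (`0`-indexed) and `1` in all other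
slots. -/
def slotP : (n : ℕ) → ℕ → H → TP K H n
  | 0, _, _ => 1
  | 1, _, h => h
  | (n + 2), i, h =>
      if i = n + 1 then ((1 : TP K H (n + 1)) ⊗ₜ[K] h : TP K H (n + 1) ⊗[K] H)
      else ((slotP (n + 1) i h) ⊗ₜ[K] (1 : H) : TP K H (n + 1) ⊗[K] H)

/-- The pure tensor `x₀ ⊗ x₁ ⊗ ⋯ ⊗ x_{n-1} ∈ H^{⊗_K n}`, written as the product of its
slot components. -/
def chainP (n : ℕ) (x : Fin n → H) : TP K H n :=
  (List.ofFn (fun i : Fin n => slotP K H n (i : ℕ) (x i))).prod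

variable {R : Type u} [Ring R] [Algebra K R]

/-- The relator `1 ⊗ ⋯ ⊗ β(r) ⊗ 1 ⊗ ⋯ ⊗ 1 − 1 ⊗ ⋯ ⊗ 1 ⊗ α(r) ⊗ ⋯ ⊗ 1` with `β(r)` in
slot `i` and `α(r)` in slot `i + 1` (`0`-indexed). -/
def relator (αf βf : R → H) (n : ℕ) (r : R) (i : ℕ) : TP K H n :=
  slotP K H n i (βf r) - slotP K H n (i + 1) (αf r)

/-- The right ideal `I_n ⊆ H^{⊗_K n}` generated by the relators. -/
def Idl (αf βf : R → H) (n : ℕ) : Submodule K (TP K H n) :=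
  Submodule.span K
    {z | ∃ (r : R) (i : ℕ) (x : TP K H n), i + 2 ≤ n ∧ z = relator K H αf βf n r i * x}

/-- The `n`-fold tensor power `H^{⊗_R n} := H^{⊗_K n} / I_n` of `H` over `R`
(`H^{⊗_R 1} = H` and, by convention, `H^{⊗_R 0} = R` is treated separately). -/
abbrev QT (αf βf : R → H) (n : ℕ) : Type u := TP K H n ⧸ Idl K H αf βf n

/-- The quotient map `H^{⊗_K n} → H^{⊗_R n}`. -/
abbrev qtMk (αf βf : R → H) (n : ℕ) : TP K H n →ₗ[K] QT K H αf βf n :=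
  (Idl K H αf βf n).mkQ

variable (R)

/-- A Hopf algebroid `(H, α, β, ·, Δ, ε)` over `R`, in the sense of Xu, together with its
(uniquely characterized) iterated coproducts `Δⁿ`.  The source map `α` (an algebra
homomorphism) and the target map `β` (an algebra anti-homomorphism) are taken as
parameters.  All conditions on elements of the quotients `H^{⊗_R n}` are expressed via
arbitrary lifts along the quotient maps. -/
structure HopfAlgebroid (α : R →ₐ[K] H) (β : R →ₗ[K] H) : Type u where
  β_one : β 1 = 1
  /-- `β` is an algebra anti-homomorphism -/
  β_mul : ∀ a b : R, β (a * b) = β b * β a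
  /-- the images of `α` and `β` commute -/
  αβ_comm : ∀ a b : R, α a * β b = β b * α a
  /-- the coproduct -/
  Δ : H →ₗ[K] QT K H (fun a => α a) (fun a => β a) 2
  Δ_one : Δ 1 = qtMk K H (fun a => α a) (fun a => β a) 2 1
  /-- `Δ(x) · (β(a) ⊗ 1 − 1 ⊗ α(a)) = 0` -/
  Δ_compat : ∀ (x : H) (a : R) (s : TP K H 2),
    qtMk K H (fun a => α a) (fun a => β a) 2 s = Δ x →
    qtMk K H (fun a => α a) (fun a => β a) 2
      (s * relator K H (fun a => α a) (fun a => β a) 2 a 0) = 0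
  /-- `Δ(x₁ x₂) = Δ(x₁) · Δ(x₂)` -/
  Δ_mul : ∀ (x y : H) (s t : TP K H 2),
    qtMk K H (fun a => α a) (fun a => β a) 2 s = Δ x →
    qtMk K H (fun a => α a) (fun a => β a) 2 t = Δ y →
    Δ (x * y) = qtMk K H (fun a => α a) (fun a => β a) 2 (s * t)
  /-- `Δ` is a morphism of `(R,R)`-bimodules, left action -/
  Δ_bimod_left : ∀ (a : R) (x : H) (s : TP K H 2),
    qtMk K H (fun a => α a) (fun a => β a) 2 s = Δ x →
    Δ (α a * x) = qtMk K H (fun a => α a) (fun a => β a) 2 (slotP K H 2 0 (α a) * s)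
  /-- `Δ` is a morphism of `(R,R)`-bimodules, right action -/
  Δ_bimod_right : ∀ (a : R) (x : H) (s : TP K H 2),
    qtMk K H (fun a => α a) (fun a => β a) 2 s = Δ x →
    Δ (β a * x) = qtMk K H (fun a => α a) (fun a => β a) 2 (slotP K H 2 1 (β a) * s)
  /-- coassociativity `(Δ ⊗_R id) ∘ Δ = (id ⊗_R Δ) ∘ Δ` -/
  coassoc : ∀ (x : H) (C : ℕ) (uu vv : Fin C → H),
    qtMk K H (fun a => α a) (fun a => β a) 2 (∑ c, (uu c ⊗ₜ[K] vv c : TP K H 2)) = Δ x →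
    ∀ s t : Fin C → TP K H 2,
      (∀ c, qtMk K H (fun a => α a) (fun a => β a) 2 (s c) = Δ (uu c)) →
      (∀ c, qtMk K H (fun a => α a) (fun a => β a) 2 (t c) = Δ (vv c)) →
      qtMk K H (fun a => α a) (fun a => β a) 3 (∑ c, (s c ⊗ₜ[K] vv c : TP K H 3)) =
        qtMk K H (fun a => α a) (fun a => β a) 3
          (∑ c, (TensorProduct.assoc K H H H).symm (uu c ⊗ₜ[K] t c))
  /-- the counit -/
  ε : H →ₗ[K] R
  ε_one : ε 1 = 1
  ε_bimod_left : ∀ (a : R) (x : H), ε (α a * x) = a * ε x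
  ε_bimod_right : ∀ (a : R) (x : H), ε (β a * x) = ε x * a
  /-- `(ε ⊗_R id) ∘ Δ = id` -/
  counit_left : ∀ (x : H) (C : ℕ) (uu vv : Fin C → H),
    qtMk K H (fun a => α a) (fun a => β a) 2 (∑ c, (uu c ⊗ₜ[K] vv c : TP K H 2)) = Δ x →
    ∑ c, α (ε (uu c)) * vv c = x
  /-- `(id ⊗_R ε) ∘ Δ = id` -/
  counit_right : ∀ (x : H) (C : ℕ) (uu vv : Fin C → H),
    qtMk K H (fun a => α a) (fun a => β a) 2 (∑ c, (uu c ⊗ₜ[K] vv c : TP K H 2)) = Δ x →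
    ∑ c, β (ε (vv c)) * uu c = x
  /-- `ker ε` is a left ideal of `H` -/
  ker_ε_ideal : ∀ x y : H, ε y = 0 → ε (x * y) = 0
  /-- the iterated coproducts `Δⁿ : H → H^{⊗_R (n+1)}` -/
  Δpow : ∀ n : ℕ, H →ₗ[K] QT K H (fun a => α a) (fun a => β a) (n + 1)
  Δpow_zero : ∀ x : H, Δpow 0 x = qtMk K H (fun a => α a) (fun a => β a) 1 x
  Δpow_one : Δpow 1 = Δ
  /-- `Δ^{n+1} = (Δⁿ ⊗_R id) ∘ Δ` -/
  Δpow_succ : ∀ (n : ℕ) (x : H) (C : ℕ) (uu vv : Fin C → H),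
    qtMk K H (fun a => α a) (fun a => β a) 2 (∑ c, (uu c ⊗ₜ[K] vv c : TP K H 2)) = Δ x →
    ∀ s : Fin C → TP K H (n + 1),
      (∀ c, qtMk K H (fun a => α a) (fun a => β a) (n + 1) (s c) = Δpow n (uu c)) →
      Δpow (n + 1) x =
        qtMk K H (fun a => α a) (fun a => β a) (n + 2)
          (∑ c, (s c ⊗ₜ[K] vv c : TP K H (n + 2)))

namespace HopfAlgebroid

variable {K H R}
variable {α : R →ₐ[K] H} {β : R →ₗ[K] H} (D : HopfAlgebroid K H R α β)

/-- The left `H`-module structure `h ▷ a := ε(h · α(a))` on `R`. -/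
def hAct (h : H) (a : R) : R := D.ε (h * α a)

end HopfAlgebroid

/-- The sign `(-1)^t` in the field `K`, for an integer exponent `t`. -/
def sgn (K : Type u) [Field K] (t : ℤ) : K := ((((-1 : Kˣ)) ^ t : Kˣ) : K)
/-! ### The graded space `⊕ₙ H^{⊗_R n}` -/

/-- Splicing a pure tensor: replace the slot `i` of `x₀ ⊗ ⋯ ⊗ x_n` by `u ⊗ v`. -/
def spliceAt {H : Type u} {n : ℕ} (x : Fin (n + 1) → H) (i : Fin (n + 1)) (u v : H) :
    Fin (n + 2) → H := fun j =>
  if _ : (j : ℕ) < (i : ℕ) then x ⟨(j : ℕ), by omega⟩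
  else if _ : (j : ℕ) = (i : ℕ) then u
  else if _ : (j : ℕ) = (i : ℕ) + 1 then v
  else x ⟨(j : ℕ) - 1, by have := j.isLt; omega⟩

section GradedSpace

variable (K : Type u) [Field K] [CharZero K]
variable (H : Type u) [Ring H] [Algebra K H]
variable {R : Type u} [Ring R] [Algebra K R]
variable (αf βf : R → H)

/-- The degree-`n` component `P_H(n)` of the graded space `⊕ₙ H^{⊗_R n}[-n]`:
`P_H(0) = R` and `P_H(n) = H^{⊗_R n}` for `n ≥ 1`. -/
@[reducible] def PH : ℕ → Type u
  | 0 => R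
  | (n + 1) => QT K H αf βf (n + 1)

instance PH.instAddCommGroup : ∀ n : ℕ, AddCommGroup (PH K H αf βf n)
  | 0 => inferInstanceAs (AddCommGroup R)
  | (n + 1) => inferInstanceAs (AddCommGroup (QT K H αf βf (n + 1)))

instance PH.instModule : ∀ n : ℕ, Module K (PH K H αf βf n)
  | 0 => inferInstanceAs (Module K R)
  | (n + 1) => inferInstanceAs (Module K (QT K H αf βf (n + 1)))

/-- Transport along an equality of degrees. -/
def phCast {a b : ℕ} (h : a = b) (x : PH K H αf βf a) : PH K H αf βf b := h ▸ x

end GradedSpace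
/-- Inserting a block `b` of length `m + 1` into slot `i` of the pure tensor
`x₀ ⊗ ⋯ ⊗ x_n` (the slot `i` is deleted; it is consumed by the block). -/
def insChain {H : Type u} {n m : ℕ} (i : Fin (n + 1)) (x : Fin (n + 1) → H)
    (b : Fin (m + 1) → H) : Fin (n + (m + 1)) → H := fun j =>
  if h1 : (j : ℕ) < (i : ℕ) then x ⟨(j : ℕ), by omega⟩
  else if h2 : (j : ℕ) < (i : ℕ) + (m + 1) then b ⟨(j : ℕ) - (i : ℕ), by omega⟩
  else x ⟨(j : ℕ) - m, by have := j.isLt; have := i.isLt; omega⟩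
section Shorthands

variable (K : Type u) [Field K] [CharZero K]
variable (H : Type u) [Ring H] [Algebra K H]
variable {R : Type u} [Ring R] [Algebra K R]

/-- Shorthand for the components of `⊕ₙ H^{⊗_R n}[-n]` attached to `(α, β)`. -/
@[reducible] def PHb (α : R →ₐ[K] H) (β : R →ₗ[K] H) : ℕ → Type u :=
  PH K H (fun a => α a) (fun a => β a)

/-- Shorthand for the quotient maps attached to `(α, β)`. -/
@[reducible] def qmk (α : R →ₐ[K] H) (β : R →ₗ[K] H) (n : ℕ) :
    TP K H n →ₗ[K] QT K H (fun a => α a) (fun a => β a) n :=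
  qtMk K H (fun a => α a) (fun a => β a) n

end Shorthands
/-! ### Twistor-type elements: common definitions -/

section TwistorBasics

variable {K : Type u} [Field K] [CharZero K]
variable {H : Type u} [Ring H] [Algebra K H]
variable {R : Type u} [Ring R] [Algebra K R]
variable {α : R →ₐ[K] H} {β : R →ₗ[K] H}

/-- Given a presentation `F = Σ_c (p c) ⊗_R (q c)` of an element of `H ⊗_R H`, the
induced product `a ⋆_F b := (F₁ ▷ a) · (F₂ ▷ b)` on `R`. -/
def starF (D : HopfAlgebroid K H R α β) {C : ℕ} (p q : Fin C → H) (a b : R) : R :=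
  ∑ c, D.hAct (p c) a * D.hAct (q c) b

/-- The twisted source map `α_F(a) := α(F₁ ▷ a) · F₂`. -/
def alphaF (D : HopfAlgebroid K H R α β) {C : ℕ} (p q : Fin C → H) (a : R) : H :=
  ∑ c, α (D.hAct (p c) a) * q c

/-- The twisted target map `β_F(a) := β(F₂ ▷ a) · F₁`. -/
def betaF (D : HopfAlgebroid K H R α β) {C : ℕ} (p q : Fin C → H) (a : R) : H :=
  ∑ c, β (D.hAct (q c) a) * p c

/-- The twistor equation (T1):
`(Δ ⊗_R id)(F) · (F ⊗_R 1) = (id ⊗_R Δ)(F) · (1 ⊗_R F)` in `H^{⊗_R 3}`, expressed via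
a presentation `F = Σ_c (p c) ⊗_R (q c)` and lifts `s c`, `t c` of `Δ(p c)`, `Δ(q c)`. -/
def TwistorEq1 (D : HopfAlgebroid K H R α β) {C : ℕ} (p q : Fin C → H)
    (s t : Fin C → TP K H 2) : Prop :=
  qtMk K H (fun a => α a) (fun a => β a) 3
      ((∑ c, (s c ⊗ₜ[K] q c : TP K H 3)) *
        (∑ c, ((p c ⊗ₜ[K] q c : TP K H 2) ⊗ₜ[K] (1 : H) : TP K H 3))) =
    qtMk K H (fun a => α a) (fun a => β a) 3
      ((∑ c, (TensorProduct.assoc K H H H).symm (p c ⊗ₜ[K] t c)) *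
        (∑ c, (TensorProduct.assoc K H H H).symm ((1 : H) ⊗ₜ[K] (p c ⊗ₜ[K] q c : TP K H 2))))

/-- The counit condition (T2): `(ε ⊗_R id)F = (id ⊗_R ε)F = 1`. -/
def TwistorEq2 (D : HopfAlgebroid K H R α β) {C : ℕ} (p q : Fin C → H) : Prop :=
  (∑ c, α (D.ε (p c)) * q c = 1) ∧ (∑ c, β (D.ε (q c)) * p c = 1)

end TwistorBasics
/-! ### Twistors of Hopf algebroids -/

section Twistors

variable {K : Type u} [Field K] [CharZero K]
variable {H : Type u} [Ring H] [Algebra K H]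
variable {R : Type u} [Ring R] [Algebra K R]

/-- The relations defining `M₁ ⊗_R M₂` for two left `H`-modules `M₁`, `M₂` (with actions
`ρ₁`, `ρ₂`), relative to source/target maps `αf, βf : R → H`. -/
def modRel (K : Type u) [Field K] {H : Type u} [Ring H] [Algebra K H]
    {R : Type u} (αf βf : R → H)
    {M₁ M₂ : Type u} [AddCommGroup M₁] [Module K M₁] [AddCommGroup M₂] [Module K M₂]
    (ρ₁ : H →ₐ[K] Module.End K M₁) (ρ₂ : H →ₐ[K] Module.End K M₂) :
    Submodule K (M₁ ⊗[K] M₂) :=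
  Submodule.span K
    {z | ∃ (r : R) (m : M₁) (m' : M₂),
      z = (ρ₁ (βf r) m) ⊗ₜ[K] m' - m ⊗ₜ[K] (ρ₂ (αf r) m')}

variable {α : R →ₐ[K] H} {β : R →ₗ[K] H}

/-- `F = Σ_c (p c) ⊗_R (q c)` is a **twistor** of the Hopf algebroid `H`: it satisfies
the twistor equation (T1) and the counit condition (T2), and for any two left
`H`-modules `M₁`, `M₂` the induced map `F♯ : M₁ ⊗_{R_F} M₂ → M₁ ⊗_R M₂` is invertible. -/
def IsTwistor (D : HopfAlgebroid K H R α β) {C : ℕ} (p q : Fin C → H) : Prop :=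
  (∃ s t : Fin C → TP K H 2,
    (∀ c, qmk K H α β 2 (s c) = D.Δ (p c)) ∧
    (∀ c, qmk K H α β 2 (t c) = D.Δ (q c)) ∧ TwistorEq1 D p q s t) ∧
  TwistorEq2 D p q ∧
  ∀ (M₁ : Type u) [AddCommGroup M₁] [Module K M₁]
    (M₂ : Type u) [AddCommGroup M₂] [Module K M₂]
    (ρ₁ : H →ₐ[K] Module.End K M₁) (ρ₂ : H →ₐ[K] Module.End K M₂),
    ∃ G : ((M₁ ⊗[K] M₂) ⧸ modRel K (alphaF D p q) (betaF D p q) ρ₁ ρ₂) →ₗ[K]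
        ((M₁ ⊗[K] M₂) ⧸ modRel K (fun a => α a) (fun a => β a) ρ₁ ρ₂),
      (∀ w : M₁ ⊗[K] M₂,
        G (Submodule.Quotient.mk w) =
          Submodule.Quotient.mk (∑ c, TensorProduct.map (ρ₁ (p c)) (ρ₂ (q c)) w)) ∧
      Function.Bijective G

variable (D : HopfAlgebroid K H R α β) {C : ℕ} (p q : Fin C → H)

/-- The family `e n` of lifts of the elements
`E_n = F_{1∧⋯∧n−1,n} ⋯ F_{1∧2,3} · F_{1,2} ∈ H^{⊗_R n}` (with `E₁ = 1`, `E₂ = F`,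
`E_{n+1} = (Δ^{n−1} ⊗_R id)(F) · (E_n ⊗_R 1)`). -/
def IsEChain (e : ∀ n : ℕ, TP K H n) : Prop :=
  (qmk K H α β 1 (e 1) = qmk K H α β 1 1) ∧
  (qmk K H α β 2 (e 2) = qmk K H α β 2 (∑ c, (p c ⊗ₜ[K] q c : TP K H 2))) ∧
  ∀ (n : ℕ) (CP : Fin C → ℕ) (ZP : (c : Fin C) → Fin (CP c) → Fin (n + 1) → H),
    (∀ c, qmk K H α β (n + 1) (∑ d, chainP K H (n + 1) (ZP c d)) = D.Δpow n (p c)) →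
    qmk K H α β (n + 2) (e (n + 2)) =
      qmk K H α β (n + 2)
        ((∑ c, ∑ d : Fin (CP c), chainP K H (n + 2) (Fin.snoc (ZP c d) (q c))) *
          (show TP K H (n + 2) from e (n + 1) ⊗ₜ[K] (1 : H)))

/-- The degreewise components `F♯ : H^{⊗_{R_F} n} → H^{⊗_R n}` of the map `F♯`:
`F♯(x₁ ⊗_{R_F} ⋯ ⊗_{R_F} x_n) = E_n · (x₁ ⊗_R ⋯ ⊗_R x_n)`, and `F♯ = id` in degree 0. -/
def IsFSharp (e : ∀ n : ℕ, TP K H n)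
    (Fs : ∀ n : ℕ, PH K H (alphaF D p q) (betaF D p q) n →ₗ[K]
        PH K H (fun a => α a) (fun a => β a) n) : Prop :=
  (∀ a : R, Fs 0 a = a) ∧
  ∀ (n : ℕ) (x : Fin (n + 1) → H),
    Fs (n + 1) (qtMk K H (alphaF D p q) (betaF D p q) (n + 1) (chainP K H (n + 1) x)) =
      qmk K H α β (n + 1) (e (n + 1) * chainP K H (n + 1) x)

/-- The binary brace operations `F{x, y}` with head the twistor `F`, on the graded space
`⊕ₙ H^{⊗_R n}`: on sums of pure tensors,
`F{x, y} = (−1)^{|x|(|y|−1)} (Δ^{|x|−1} ⊗ Δ^{|y|−1})(F) · (x ⊗_R y)`; insertions of the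
degree-`0` component `R` are absorbed through `α_F`, `β_F` and `⋆_F`. -/
def IsFBrace
    (Fbr : ∀ n m : ℕ, PH K H (fun a => α a) (fun a => β a) n →ₗ[K]
        PH K H (fun a => α a) (fun a => β a) m →ₗ[K]
        PH K H (fun a => α a) (fun a => β a) (n + m)) : Prop :=
  -- main clause: both arguments of degree `≥ 1`
  (∀ (n m : ℕ) (x : Fin (n + 1) → H) (y : Fin (m + 1) → H)
      (CP CQ : Fin C → ℕ)
      (ZP : (c : Fin C) → Fin (CP c) → Fin (n + 1) → H)
      (ZQ : (c : Fin C) → Fin (CQ c) → Fin (m + 1) → H),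
    (∀ c, qmk K H α β (n + 1) (∑ d, chainP K H (n + 1) (ZP c d)) = D.Δpow n (p c)) →
    (∀ c, qmk K H α β (m + 1) (∑ d, chainP K H (m + 1) (ZQ c d)) = D.Δpow m (q c)) →
    Fbr (n + 1) (m + 1)
        (qmk K H α β (n + 1) (chainP K H (n + 1) x))
        (qmk K H α β (m + 1) (chainP K H (m + 1) y)) =
      sgn K (((n : ℤ) + 1) * (m : ℤ)) •
        qmk K H α β ((n + 1) + (m + 1))
          (∑ c, ∑ d : Fin (CP c), ∑ d' : Fin (CQ c),
            chainP K H ((n + 1) + (m + 1))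
              (Fin.append (fun t => ZP c d t * x t) (fun t => ZQ c d' t * y t)))) ∧
  -- left argument of degree `0`: `F{a, y} = (Δ^{|y|−1} α_F(a)) · y`
  (∀ (m : ℕ) (a : R) (y : Fin (m + 1) → H) (CA : ℕ) (ZA : Fin CA → Fin (m + 1) → H),
    qmk K H α β (m + 1) (∑ d, chainP K H (m + 1) (ZA d)) = D.Δpow m (alphaF D p q a) →
    Fbr 0 (m + 1) a (qmk K H α β (m + 1) (chainP K H (m + 1) y)) =
      phCast K H (fun a => α a) (fun a => β a) (a := m + 1) (b := 0 + (m + 1)) (by omega)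
        (qmk K H α β (m + 1) (∑ d, chainP K H (m + 1) (fun t => ZA d t * y t)))) ∧
  -- right argument of degree `0`: `F{x, a} = (−1)^{|x|} (Δ^{|x|−1} β_F(a)) · x`
  (∀ (n : ℕ) (a : R) (x : Fin (n + 1) → H) (CB : ℕ) (ZB : Fin CB → Fin (n + 1) → H),
    qmk K H α β (n + 1) (∑ d, chainP K H (n + 1) (ZB d)) = D.Δpow n (betaF D p q a) →
    Fbr (n + 1) 0 (qmk K H α β (n + 1) (chainP K H (n + 1) x)) a =
      sgn K ((n : ℤ) + 1) •
        qmk K H α β (n + 1) (∑ d, chainP K H (n + 1) (fun t => ZB d t * x t))) ∧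
  -- both arguments of degree `0`: `F{a, b} = a ⋆_F b`
  (∀ a b : R, Fbr 0 0 a b = starF D p q a b)

end Twistors

/-! ### Generic concatenation products, iterated coproducts and compositions -/

section Generic

variable {K : Type u} [Field K] [CharZero K]
variable {H : Type u} [Ring H] [Algebra K H]
variable {R : Type u} [Ring R] [Algebra K R]

/-- The concatenation product on `⊕ₙ H^{⊗_R n}` relative to source/target maps
`αf, βf`, a product `mulR` on the degree-`0` part `R`, and a coefficient system `coef`
(`coef n m = (−1)^{nm}` for the cup product, `coef = 1` for the plain tensor
concatenation). -/
def IsConcatOn (αf βf : R → H) (mulR : R → R → R) (coef : ℕ → ℕ → K)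
    (cup : ∀ n m : ℕ, PH K H αf βf n →ₗ[K] PH K H αf βf m →ₗ[K] PH K H αf βf (n + m)) :
    Prop :=
  (∀ (n m : ℕ) (x : Fin (n + 1) → H) (y : Fin (m + 1) → H),
    cup (n + 1) (m + 1)
        (qtMk K H αf βf (n + 1) (chainP K H (n + 1) x))
        (qtMk K H αf βf (m + 1) (chainP K H (m + 1) y)) =
      coef (n + 1) (m + 1) •
        qtMk K H αf βf ((n + 1) + (m + 1))
          (chainP K H ((n + 1) + (m + 1)) (Fin.append x y))) ∧
  (∀ (m : ℕ) (a : R) (y : Fin (m + 1) → H),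
    cup 0 (m + 1) a (qtMk K H αf βf (m + 1) (chainP K H (m + 1) y)) =
      phCast K H αf βf (a := m + 1) (b := 0 + (m + 1)) (by omega)
        (qtMk K H αf βf (m + 1) (slotP K H (m + 1) 0 (αf a) * chainP K H (m + 1) y))) ∧
  (∀ (n : ℕ) (a : R) (x : Fin (n + 1) → H),
    cup (n + 1) 0 (qtMk K H αf βf (n + 1) (chainP K H (n + 1) x)) a =
      qtMk K H αf βf (n + 1) (slotP K H (n + 1) n (βf a) * chainP K H (n + 1) x)) ∧
  (∀ a b : R, cup 0 0 a b = mulR a b)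

/-- A family `Δp` is the family of iterated coproducts of a coproduct `Δ2`, relative to
source/target maps `αf, βf`. -/
def IsIteratedOn (αf βf : R → H) (Δ2 : H →ₗ[K] QT K H αf βf 2)
    (Δp : ∀ n : ℕ, H →ₗ[K] QT K H αf βf (n + 1)) : Prop :=
  (∀ x : H, Δp 0 x = qtMk K H αf βf 1 x) ∧
  (Δp 1 = Δ2) ∧
  ∀ (n : ℕ) (x : H) (C : ℕ) (uu vv : Fin C → H),
    qtMk K H αf βf 2 (∑ c, (uu c ⊗ₜ[K] vv c : TP K H 2)) = Δ2 x →
    ∀ s : Fin C → TP K H (n + 1),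
      (∀ c, qtMk K H αf βf (n + 1) (s c) = Δp n (uu c)) →
      Δp (n + 1) x = qtMk K H αf βf (n + 2) (∑ c, (s c ⊗ₜ[K] vv c : TP K H (n + 2)))

/-- The defining clauses of the operadic partial composition maps of the operad
`P_H` attached to the data `(αf, βf, act, Δp)`; cf. Statement 1. -/
def IsCompOn (αf βf : R → H) (act : H → R → R)
    (Δp : ∀ n : ℕ, H →ₗ[K] QT K H αf βf (n + 1))
    (comp : ∀ (n m : ℕ), Fin (n + 1) →
      (PH K H αf βf (n + 1) →ₗ[K] PH K H αf βf m →ₗ[K] PH K H αf βf (n + m))) : Prop :=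
  (∀ (n m : ℕ) (i : Fin (n + 1)) (x : Fin (n + 1) → H) (y : Fin (m + 1) → H)
      (C : ℕ) (z : Fin C → Fin (m + 1) → H),
    qtMk K H αf βf (m + 1) (∑ c, chainP K H (m + 1) (z c)) = Δp m (x i) →
    comp n (m + 1) i
        (qtMk K H αf βf (n + 1) (chainP K H (n + 1) x))
        (qtMk K H αf βf (m + 1) (chainP K H (m + 1) y)) =
      qtMk K H αf βf (n + (m + 1))
        (∑ c, chainP K H (n + (m + 1)) (insChain i x (fun t => z c t * y t)))) ∧
  (∀ (i : Fin 1) (h : H) (a : R),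
    comp 0 0 i (qtMk K H αf βf 1 h) a = act h a) ∧
  (∀ (n : ℕ) (i : Fin (n + 2)) (x : Fin (n + 2) → H) (a : R),
    comp (n + 1) 0 i (qtMk K H αf βf (n + 2) (chainP K H (n + 2) x)) a =
      qtMk K H αf βf (n + 1)
        (chainP K H (n + 1) (fun j : Fin (n + 1) =>
          if (i : ℕ) ≤ n then
            (if (j : ℕ) < (i : ℕ) then x ⟨(j : ℕ), by omega⟩
             else if (j : ℕ) = (i : ℕ) then αf (act (x i) a) * x ⟨(j : ℕ) + 1, by omega⟩
             else x ⟨(j : ℕ) + 1, by omega⟩)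
          else
            (if (j : ℕ) + 1 = n + 1 then βf (act (x i) a) * x ⟨(j : ℕ), by omega⟩
             else x ⟨(j : ℕ), by omega⟩))))

/-- Iterated binary operation `(⋯(y₁ ⊚ y₂) ⊚ ⋯ ) ⊚ y_k` on a graded family. -/
def foldOp {F : ℕ → Type u} (c : ∀ a b : ℕ, F a → F b → F (a + b)) :
    ∀ {k : ℕ} (deg : Fin (k + 1) → ℕ), ((i : Fin (k + 1)) → F (deg i)) → F (∑ i, deg i)
  | 0, deg, y => (show deg 0 = ∑ i, deg i by simp) ▸ y 0
  | (k + 1), deg, y =>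
      (show (∑ i : Fin (k + 1), deg i.castSucc) + deg (Fin.last (k + 1)) = ∑ i, deg i from
        (Fin.sum_univ_castSucc deg).symm) ▸
        c _ _ (foldOp c (fun i => deg i.castSucc) (fun i => y i.castSucc))
          (y (Fin.last (k + 1)))

end Generic
section Aux

variable {K : Type u} [Field K]
variable {H : Type u} [Ring H] [Algebra K H]
variable {R : Type u}

/-- tensor action of `H ⊗ H` -/
def Th {M N : Type u} [AddCommGroup M] [Module K M] [AddCommGroup N] [Module K N]
    (ρ₁ : H →ₐ[K] Module.End K M) (ρ₂ : H →ₐ[K] Module.End K N) :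
    H ⊗[K] H →ₐ[K] Module.End K (M ⊗[K] N) :=
  (Module.endTensorEndAlgHom (R := K) (S := K) (A := K) (M := M) (N := N)).comp
    (Algebra.TensorProduct.map ρ₁ ρ₂)

section
variable {M N : Type u} [AddCommGroup M] [Module K M] [AddCommGroup N] [Module K N]
    (ρ₁ : H →ₐ[K] Module.End K M) (ρ₂ : H →ₐ[K] Module.End K N)

theorem Th_tmul (a b : H) (m : M) (n : N) :
    Th ρ₁ ρ₂ (a ⊗ₜ b) (m ⊗ₜ n) = (ρ₁ a m) ⊗ₜ (ρ₂ b n) := by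
  simp [Th]; rfl

theorem Th_map (a b : H) :
    Th ρ₁ ρ₂ (a ⊗ₜ b) = TensorProduct.map (ρ₁ a) (ρ₂ b) := by
  ext m n; simp [Th]; rfl

variable (αf βf : R → H)

theorem Th_modRel (t : H ⊗[K] H) (ht : t ∈ modRel K αf βf (Algebra.lmul K H) (Algebra.lmul K H))
    (w : M ⊗[K] N) : Th ρ₁ ρ₂ t w ∈ modRel K αf βf ρ₁ ρ₂ := by
  induction w with
  | zero => simp
  | add x y hx hy => rw [map_add]; exact add_mem hx hy
  | tmul m n =>
    induction ht using Submodule.span_induction with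
    | zero => simp
    | add x y _ _ hx hy => rw [map_add]; exact add_mem hx hy
    | smul a x _ hx => rw [map_smul]; exact Submodule.smul_mem _ _ hx
    | mem x hx =>
      obtain ⟨r, a, b, rfl⟩ := hx
      refine Submodule.subset_span ⟨r, ρ₁ a m, ρ₂ b n, ?_⟩
      rw [map_sub, LinearMap.sub_apply, Th_tmul, Th_tmul]
      simp [map_mul]

theorem modRel_right (t : H ⊗[K] H)
    (ht : t ∈ modRel K αf βf (Algebra.lmul K H) (Algebra.lmul K H)) (w : H ⊗[K] H) :
    t * w ∈ modRel K αf βf (Algebra.lmul K H) (Algebra.lmul K H) := by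
  have := Th_modRel (Algebra.lmul K H) (Algebra.lmul K H) αf βf t ht w
  have h : ∀ t w : H ⊗[K] H, Th (Algebra.lmul K H) (Algebra.lmul K H) t w = t * w := by
    intro t w
    induction t with
    | zero => simp
    | add x y hx hy => rw [map_add, add_mul, LinearMap.add_apply, hx, hy]
    | tmul a b =>
      induction w with
      | zero => simp
      | add x y hx hy => rw [map_add, hx, hy, mul_add]
      | tmul m n => rw [Th_tmul]; simp
  rwa [h] at this

/-- `t` normalises the relations -/
def Nrm (t : H ⊗[K] H) : Prop :=
  ∀ r : R, t * (βf r ⊗ₜ[K] (1 : H) - (1 : H) ⊗ₜ[K] αf r) ∈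
    modRel K αf βf (Algebra.lmul K H) (Algebra.lmul K H)

theorem Th_nrm (t : H ⊗[K] H) (ht : Nrm αf βf t)
    (w : M ⊗[K] N) (hw : w ∈ modRel K αf βf ρ₁ ρ₂) :
    Th ρ₁ ρ₂ t w ∈ modRel K αf βf ρ₁ ρ₂ := by
  induction hw using Submodule.span_induction with
  | zero => simp
  | add x y _ _ hx hy => rw [map_add]; exact add_mem hx hy
  | smul a x _ hx => rw [map_smul]; exact Submodule.smul_mem _ _ hx
  | mem x hx =>
    obtain ⟨r, a, b, rfl⟩ := hx
    have := Th_modRel ρ₁ ρ₂ αf βf _ (ht r) (a ⊗ₜ b)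
    rw [map_mul, Module.End.mul_apply, map_sub, LinearMap.sub_apply, Th_tmul, Th_tmul] at this
    simpa using this

end

section Ker
variable {A : Type u} [Ring A] [Algebra K A]
variable (αf βf : R → H)

/-- the next ideal -/
def nextI (bl : H → A) (J : Submodule K A) : Submodule K (A ⊗[K] H) :=
  Submodule.span K ({z | ∃ j ∈ J, ∃ b : H, z = j ⊗ₜ b} ∪
    {z | ∃ (r : R) (a : A) (b : H), z = (bl (βf r) * a) ⊗ₜ b - a ⊗ₜ (αf r * b)})

theorem ker_next (bl : H → A) (J : Submodule K A)
    {M : Type u} [AddCommGroup M] [Module K M] (ρ : H →ₐ[K] Module.End K M)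
    (f : A →ₗ[K] M) (hf : Function.Surjective f) (hk : ∀ x, f x = 0 ↔ x ∈ J)
    (hb : ∀ r x, ρ (βf r) (f x) = f (bl (βf r) * x)) (x : A ⊗[K] H) :
    f.rTensor H x ∈ modRel K αf βf ρ (Algebra.lmul K H) ↔ x ∈ nextI αf βf bl J := by
  constructor
  · intro h
    have h1 : modRel K αf βf ρ (Algebra.lmul K H) ≤ (nextI αf βf bl J).map (f.rTensor H) := by
      refine Submodule.span_le.2 ?_
      rintro _ ⟨r, m, b, rfl⟩
      obtain ⟨a, rfl⟩ := hf m
      refine ⟨(bl (βf r) * a) ⊗ₜ b - a ⊗ₜ (αf r * b),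
        Submodule.subset_span (Or.inr ⟨r, a, b, rfl⟩), ?_⟩
      simp [hb]
    obtain ⟨y, hy, hxy⟩ := h1 h
    have h2 : x - y ∈ LinearMap.ker (f.rTensor H) := by
      rw [LinearMap.mem_ker, map_sub, hxy, sub_self]
    have hex : Function.Exact J.subtype f := by
      intro z
      rw [hk]; simp
    rw [(rTensor_exact H hex hf).linearMap_ker_eq] at h2
    obtain ⟨w, hw⟩ := h2
    have h3 : ∀ w, J.subtype.rTensor H w ∈ nextI αf βf bl J := by
      intro w
      induction w with
      | zero => simp
      | add a b ha hb => rw [map_add]; exact add_mem ha hb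
      | tmul a b => exact Submodule.subset_span (Or.inl ⟨a, a.2, b, by simp⟩)
    have h4 := h3 w
    rw [hw] at h4
    simpa using add_mem h4 hy
  · intro h
    induction h using Submodule.span_induction with
    | zero => simp
    | add x y _ _ hx hy => rw [map_add]; exact add_mem hx hy
    | smul a x _ hx => rw [map_smul]; exact Submodule.smul_mem _ _ hx
    | mem x hx =>
      rcases hx with ⟨j, hj, b, rfl⟩ | ⟨r, a, b, rfl⟩
      · simp [(hk j).2 hj]
      · refine Submodule.subset_span ⟨r, f a, b, ?_⟩
        simp [hb]
end Ker
end Aux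
section Aux2

variable {K : Type u} [Field K]
variable {H : Type u} [Ring H] [Algebra K H]
variable {R : Type u}

/-- the relation submodule of `H ⊗ H` -/
abbrev NN (K : Type u) [Field K] {H : Type u} [Ring H] [Algebra K H] {R : Type u}
    (αf βf : R → H) : Submodule K (H ⊗[K] H) :=
  modRel K αf βf (Algebra.lmul K H) (Algebra.lmul K H)

/-- abstract properties of a twisted bialgebroid -/
structure Bi (αf βf αF βF : R → H) (F : H ⊗[K] H) where
  Δ : H →ₗ[K] (H ⊗[K] H) ⧸ NN K αf βf
  one : (NN K αf βf).mkQ 1 = Δ 1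
  mul : ∀ x y s t, (NN K αf βf).mkQ s = Δ x → (NN K αf βf).mkQ t = Δ y →
    (NN K αf βf).mkQ (s * t) = Δ (x * y)
  nrm : ∀ x s, (NN K αf βf).mkQ s = Δ x → Nrm αf βf s
  bet : ∀ r, (NN K αf βf).mkQ (1 ⊗ₜ βf r) = Δ (βf r)
  betF : ∀ r s, (NN K αf βf).mkQ s = Δ (βF r) →
    (NN K αf βf).mkQ (s * F) = (NN K αf βf).mkQ (F * (1 ⊗ₜ βF r))
  inj : ∀ (M : Type u) [AddCommGroup M] [Module K M] (ρ : H →ₐ[K] Module.End K M)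
    (w : M ⊗[K] H), Th ρ (Algebra.lmul K H) F w ∈ modRel K αf βf ρ (Algebra.lmul K H) ↔
      w ∈ modRel K αF βF ρ (Algebra.lmul K H)
  sur : ∀ (M : Type u) [AddCommGroup M] [Module K M] (ρ : H →ₐ[K] Module.End K M)
    (w : M ⊗[K] H), ∃ w', (modRel K αf βf ρ (Algebra.lmul K H)).mkQ
      (Th ρ (Algebra.lmul K H) F w') = (modRel K αf βf ρ (Algebra.lmul K H)).mkQ w

namespace Bi

variable {αf βf αF βF : R → H} {F : H ⊗[K] H} (B : Bi αf βf αF βF F)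

/-- chosen lift -/
def lift (h : H) : H ⊗[K] H := ((NN K αf βf).mkQ_surjective (B.Δ h)).choose

theorem lift_spec (h : H) : (NN K αf βf).mkQ (B.lift h) = B.Δ h :=
  ((NN K αf βf).mkQ_surjective (B.Δ h)).choose_spec

variable {M N : Type u} [AddCommGroup M] [Module K M] [AddCommGroup N] [Module K N]
    (ρ₁ : H →ₐ[K] Module.End K M) (ρ₂ : H →ₐ[K] Module.End K N)

theorem mk_Th_congr (s t : H ⊗[K] H) (h : (NN K αf βf).mkQ s = (NN K αf βf).mkQ t)
    (w : M ⊗[K] N) : (modRel K αf βf ρ₁ ρ₂).mkQ (Th ρ₁ ρ₂ s w) =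
      (modRel K αf βf ρ₁ ρ₂).mkQ (Th ρ₁ ρ₂ t w) := by
  rw [← sub_eq_zero, ← map_sub, Submodule.mkQ_apply, Submodule.Quotient.mk_eq_zero] at h ⊢
  rw [← LinearMap.sub_apply, ← map_sub]
  exact Th_modRel _ _ _ _ _ h _

/-- action on a tensor product, one element -/
def rho0 (h : H) : Module.End K ((M ⊗[K] N) ⧸ modRel K αf βf ρ₁ ρ₂) :=
  (modRel K αf βf ρ₁ ρ₂).mapQ _ (Th ρ₁ ρ₂ (B.lift h))
    (fun w hw => Th_nrm ρ₁ ρ₂ αf βf _ (B.nrm h _ (B.lift_spec h)) w hw)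

theorem rho0_spec (h : H) (t : H ⊗[K] H) (ht : (NN K αf βf).mkQ t = B.Δ h) (w : M ⊗[K] N) :
    B.rho0 ρ₁ ρ₂ h ((modRel K αf βf ρ₁ ρ₂).mkQ w) =
      (modRel K αf βf ρ₁ ρ₂).mkQ (Th ρ₁ ρ₂ t w) := by
  have : B.rho0 ρ₁ ρ₂ h ((modRel K αf βf ρ₁ ρ₂).mkQ w) =
      (modRel K αf βf ρ₁ ρ₂).mkQ (Th ρ₁ ρ₂ (B.lift h) w) := rfl
  rw [this]
  exact mk_Th_congr ρ₁ ρ₂ _ _ (by rw [B.lift_spec, ht]) w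

/-- action on a tensor product -/
def rho : H →ₐ[K] Module.End K ((M ⊗[K] N) ⧸ modRel K αf βf ρ₁ ρ₂) :=
  AlgHom.ofLinearMap
    { toFun := B.rho0 ρ₁ ρ₂
      map_add' := by
        intro x y
        refine LinearMap.ext fun z => ?_
        obtain ⟨w, rfl⟩ := (modRel K αf βf ρ₁ ρ₂).mkQ_surjective z
        rw [LinearMap.add_apply, B.rho0_spec ρ₁ ρ₂ x _ (B.lift_spec x),
          B.rho0_spec ρ₁ ρ₂ y _ (B.lift_spec y),
          B.rho0_spec ρ₁ ρ₂ (x + y) (B.lift x + B.lift y)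
            (by rw [map_add, map_add, B.lift_spec, B.lift_spec]),
          map_add, LinearMap.add_apply, map_add]
      map_smul' := by
        intro c x
        refine LinearMap.ext fun z => ?_
        obtain ⟨w, rfl⟩ := (modRel K αf βf ρ₁ ρ₂).mkQ_surjective z
        rw [RingHom.id_apply, LinearMap.smul_apply, B.rho0_spec ρ₁ ρ₂ x _ (B.lift_spec x),
          B.rho0_spec ρ₁ ρ₂ (c • x) (c • B.lift x)
            (by rw [map_smul, map_smul, B.lift_spec]),
          map_smul, LinearMap.smul_apply, map_smul] }
    (by
      refine LinearMap.ext fun z => ?_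
      obtain ⟨w, rfl⟩ := (modRel K αf βf ρ₁ ρ₂).mkQ_surjective z
      change B.rho0 ρ₁ ρ₂ 1 _ = _
      rw [B.rho0_spec ρ₁ ρ₂ 1 1 B.one, map_one]; rfl)
    (by
      intro x y
      refine LinearMap.ext fun z => ?_
      obtain ⟨w, rfl⟩ := (modRel K αf βf ρ₁ ρ₂).mkQ_surjective z
      rw [Module.End.mul_apply]
      change B.rho0 ρ₁ ρ₂ (x * y) _ = B.rho0 ρ₁ ρ₂ x (B.rho0 ρ₁ ρ₂ y _)
      rw [B.rho0_spec ρ₁ ρ₂ y _ (B.lift_spec y), B.rho0_spec ρ₁ ρ₂ x _ (B.lift_spec x),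
        B.rho0_spec ρ₁ ρ₂ (x * y) _ (B.mul _ _ _ _ (B.lift_spec x) (B.lift_spec y)),
        map_mul, Module.End.mul_apply])

theorem rho_spec (h : H) (t : H ⊗[K] H) (ht : (NN K αf βf).mkQ t = B.Δ h) (w : M ⊗[K] N) :
    B.rho ρ₁ ρ₂ h ((modRel K αf βf ρ₁ ρ₂).mkQ w) =
      (modRel K αf βf ρ₁ ρ₂).mkQ (Th ρ₁ ρ₂ t w) := B.rho0_spec ρ₁ ρ₂ h t ht w

end Bi

/-- one level of the construction -/
structure Lev (βf βF : R → H) (A : Type u) [Ring A] [Algebra K A] (bl : H → A)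
    (J JF : Submodule K A) where
  M : Type u
  [i1 : AddCommGroup M]
  [i2 : Module K M]
  ρ : H →ₐ[K] Module.End K M
  π : A →ₗ[K] M
  e : A
  surj : Function.Surjective π
  ker : ∀ x, π x = 0 ↔ x ∈ J
  right : ∀ x y, π x = 0 → π (x * y) = 0
  act : ∀ h s x, π s = ρ h (π 1) → ρ h (π x) = π (s * x)
  bet : ∀ r x, ρ (βf r) (π x) = π (bl (βf r) * x)
  surjF : ∀ y, ∃ x, π (e * x) = y
  kerF : ∀ x, π (e * x) = 0 ↔ x ∈ JF
  betF : ∀ r x, ρ (βF r) (π (e * x)) = π (e * (bl (βF r) * x))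

attribute [instance] Lev.i1 Lev.i2

namespace Lev

variable {αf βf αF βF : R → H} {F : H ⊗[K] H}
variable {A : Type u} [Ring A] [Algebra K A] {bl : H → A} {J JF : Submodule K A}

/-- next module -/
abbrev M' (αf : R → H) (L : Lev βf βF A bl J JF) : Type u :=
  (L.M ⊗[K] H) ⧸ modRel K αf βf L.ρ (Algebra.lmul K H)

/-- next projection -/
def π' (αf : R → H) (L : Lev βf βF A bl J JF) : A ⊗[K] H →ₗ[K] L.M' αf :=
  (modRel K αf βf L.ρ (Algebra.lmul K H)).mkQ ∘ₗ L.π.rTensor H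

/-- twisted projection -/
def πe (L : Lev βf βF A bl J JF) : A →ₗ[K] L.M := L.π ∘ₗ LinearMap.mulLeft K L.e

theorem πe_apply (L : Lev βf βF A bl J JF) (x : A) : L.πe x = L.π (L.e * x) := rfl

theorem π'_apply (L : Lev βf βF A bl J JF) (x : A ⊗[K] H) :
    L.π' αf x = (modRel K αf βf L.ρ (Algebra.lmul K H)).mkQ (L.π.rTensor H x) := rfl

theorem π'_surj (L : Lev βf βF A bl J JF) : Function.Surjective (L.π' αf) :=
  (Submodule.mkQ_surjective _).comp (LinearMap.rTensor_surjective H L.surj)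

theorem right_congr (L : Lev βf βF A bl J JF) (x x' y : A) (h : L.π x = L.π x') :
    L.π (x * y) = L.π (x' * y) := by
  rw [← sub_eq_zero, ← map_sub] at h ⊢
  rw [← sub_mul]; exact L.right _ _ h

/-- lift of the action of `h` to `A` -/
def sg (L : Lev βf βF A bl J JF) (h : H) : A := (L.surj (L.ρ h (L.π 1))).choose

theorem sg_spec (L : Lev βf βF A bl J JF) (h : H) : L.π (L.sg h) = L.ρ h (L.π 1) :=
  (L.surj (L.ρ h (L.π 1))).choose_spec

theorem sg_mul (L : Lev βf βF A bl J JF) (h : H) (x : A) : L.π (L.sg h * x) = L.ρ h (L.π x) :=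
  (L.act h _ x (L.sg_spec h)).symm

/-- lifting the action of `H ⊗ H` to `A ⊗ H` -/
theorem exists_lift (L : Lev βf βF A bl J JF) (t : H ⊗[K] H) :
    ∃ s : A ⊗[K] H, ∀ x, L.π.rTensor H (s * x) =
      Th L.ρ (Algebra.lmul K H) t (L.π.rTensor H x) := by
  induction t with
  | zero => exact ⟨0, by simp⟩
  | add a b ha hb =>
    obtain ⟨s, hs⟩ := ha
    obtain ⟨s', hs'⟩ := hb
    exact ⟨s + s', fun x => by
      rw [add_mul, map_add, hs, hs', map_add, LinearMap.add_apply]⟩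
  | tmul a b =>
    refine ⟨L.sg a ⊗ₜ b, fun x => ?_⟩
    induction x with
    | zero => simp
    | add x y hx hy => rw [mul_add, map_add, hx, hy, map_add, map_add]
    | tmul x y =>
      rw [Algebra.TensorProduct.tmul_mul_tmul, LinearMap.rTensor_tmul, LinearMap.rTensor_tmul,
        Th_tmul, L.sg_mul]; rfl

/-- next twisting element -/
def e' (αf : R → H) (L : Lev βf βF A bl J JF) (F : H ⊗[K] H) : A ⊗[K] H :=
  (L.π'_surj (αf := αf) ((modRel K αf βf L.ρ (Algebra.lmul K H)).mkQ
    (Th L.ρ (Algebra.lmul K H) F (L.π L.e ⊗ₜ 1)))).choose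

theorem e'_spec (L : Lev βf βF A bl J JF) (F : H ⊗[K] H) :
    L.π' αf (L.e' αf F) = (modRel K αf βf L.ρ (Algebra.lmul K H)).mkQ
    (Th L.ρ (Algebra.lmul K H) F (L.π L.e ⊗ₜ 1)) :=
  (L.π'_surj (αf := αf) ((modRel K αf βf L.ρ (Algebra.lmul K H)).mkQ
    (Th L.ρ (Algebra.lmul K H) F (L.π L.e ⊗ₜ 1)))).choose_spec

theorem ker' (L : Lev βf βF A bl J JF) (x) : L.π' αf x = 0 ↔ x ∈ nextI αf βf bl J := by
  rw [π'_apply, Submodule.mkQ_apply, Submodule.Quotient.mk_eq_zero]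
  exact ker_next αf βf bl J L.ρ L.π L.surj L.ker L.bet x

theorem e'_mul (L : Lev βf βF A bl J JF) (F : H ⊗[K] H)
    (hR : ∀ x y, x ∈ nextI αf βf bl J → x * y ∈ nextI αf βf bl J) (x : A ⊗[K] H) :
    L.π' αf (L.e' αf F * x) = (modRel K αf βf L.ρ (Algebra.lmul K H)).mkQ
      (Th L.ρ (Algebra.lmul K H) F (L.πe.rTensor H x)) := by
  obtain ⟨s, hs⟩ := L.exists_lift F
  have h1 : L.π' αf (L.e' αf F) = L.π' αf (s * (L.e ⊗ₜ 1)) := by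
    rw [e'_spec, π'_apply, hs, LinearMap.rTensor_tmul]
  have h2 : L.π' αf (L.e' αf F * x) = L.π' αf (s * (L.e ⊗ₜ 1) * x) := by
    rw [← sub_eq_zero, ← map_sub, L.ker'] at h1 ⊢
    rw [← sub_mul]; exact hR _ _ h1
  rw [h2, mul_assoc, π'_apply, hs]
  congr 2
  clear h2
  induction x with
  | zero => simp
  | add x y hx hy => rw [mul_add, map_add, hx, hy, map_add]
  | tmul x y => simp [πe_apply]

/-- the next level -/
def next (L : Lev βf βF A bl J JF) (B : Bi αf βf αF βF F) (bl' : H → A ⊗[K] H)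
    (hbl : ∀ h, bl' h = 1 ⊗ₜ h)
    (J' JF' : Submodule K (A ⊗[K] H)) (hJ : J' = nextI αf βf bl J)
    (hJF : JF' = nextI αF βF bl JF)
    (hR : ∀ x y, x ∈ nextI αf βf bl J → x * y ∈ nextI αf βf bl J) :
    Lev βf βF (A ⊗[K] H) bl' J' JF' where
  M := L.M' αf
  ρ := B.rho L.ρ (Algebra.lmul K H)
  π := L.π' αf
  e := L.e' αf F
  surj := L.π'_surj
  ker x := by rw [hJ, L.ker']
  right x y h := by rw [L.ker'] at h ⊢; exact hR _ _ h
  act h s x hs := by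
    obtain ⟨s', hs'⟩ := L.exists_lift (B.lift h)
    have h1 : ∀ x, B.rho L.ρ (Algebra.lmul K H) h (L.π' αf x) = L.π' αf (s' * x) := by
      intro x
      rw [π'_apply, B.rho_spec _ _ h _ (B.lift_spec h), π'_apply, hs']
    rw [h1, mul_one] at hs
    rw [h1]
    replace hs := hs.symm
    rw [← sub_eq_zero, ← map_sub, L.ker'] at hs ⊢
    rw [← sub_mul]
    exact hR _ _ hs
  bet r x := by
    rw [π'_apply, B.rho_spec _ _ _ _ (B.bet r), π'_apply, hbl]
    congr 1
    induction x with
    | zero => simp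
    | add x y hx hy => rw [mul_add, map_add, map_add, hx, hy, map_add]
    | tmul x y => simp [Th_tmul]
  surjF y := by
    obtain ⟨w, rfl⟩ := Submodule.mkQ_surjective _ y
    obtain ⟨w', hw⟩ := B.sur L.M L.ρ w
    obtain ⟨x, rfl⟩ := LinearMap.rTensor_surjective H (g := L.πe) (fun y => L.surjF y) w'
    exact ⟨x, by rw [L.e'_mul F hR, hw]⟩
  kerF x := by
    rw [L.e'_mul F hR, Submodule.mkQ_apply, Submodule.Quotient.mk_eq_zero, B.inj, hJF]
    exact ker_next αF βF bl JF L.ρ L.πe (fun y => L.surjF y) L.kerF L.betF x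
  betF r x := by
    rw [L.e'_mul F hR, L.e'_mul F hR, B.rho_spec _ _ _ _ (B.lift_spec _), ← Module.End.mul_apply,
      ← map_mul, Bi.mk_Th_congr _ _ _ _ (B.betF r _ (B.lift_spec _)), map_mul,
      Module.End.mul_apply, hbl]
    congr 2
    induction x with
    | zero => simp
    | add x y hx hy => rw [mul_add, map_add, map_add, hx, hy, map_add]
    | tmul x y => simp [Th_tmul]

/-- transport of a level along an isomorphism -/
def transport (L : Lev βf βF A bl J JF) {A' : Type u} [Ring A'] [Algebra K A'] (φ : A ≃ₐ[K] A')
    (bl' : H → A') (hbl : ∀ h, bl' h = φ (bl h)) (J' JF' : Submodule K A')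
    (hJ : ∀ x, φ x ∈ J' ↔ x ∈ J) (hJF : ∀ x, φ x ∈ JF' ↔ x ∈ JF) :
    Lev βf βF A' bl' J' JF' where
  M := L.M
  ρ := L.ρ
  π := L.π ∘ₗ φ.symm.toLinearMap
  e := φ L.e
  surj := L.surj.comp φ.symm.surjective
  ker x := by
    obtain ⟨x, rfl⟩ := φ.surjective x
    rw [hJ]; simpa using L.ker x
  right x y h := by
    simpa using L.right (φ.symm x) (φ.symm y) h
  act h s x hs := by
    simpa using L.act h (φ.symm s) (φ.symm x) (by simpa using hs)
  bet r x := by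
    simpa [hbl] using L.bet r (φ.symm x)
  surjF y := by
    obtain ⟨x, hx⟩ := L.surjF y
    exact ⟨φ x, by simpa using hx⟩
  kerF x := by
    obtain ⟨x, rfl⟩ := φ.surjective x
    rw [hJF]; simpa using L.kerF x
  betF r x := by
    simpa [hbl] using L.betF r (φ.symm x)

end Lev
end Aux2
section Aux3

variable {K : Type u} [Field K]
variable {H : Type u} [Ring H] [Algebra K H]
variable {R : Type u} 

/-- `H ⊗ ⋯ ⊗ H`, unfolding one step -/
def tpE (K : Type u) [Field K] (H : Type u) [Ring H] [Algebra K H] (n : ℕ) :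
    TP K H (n + 1) ⊗[K] H ≃ₐ[K] TP K H (n + 2) :=
  (AlgEquiv.refl : TP K H (n + 1) ⊗[K] H ≃ₐ[K] TP K H (n + 1) ⊗[K] H)

/-- `H ≃ H^{⊗ 1}` -/
def tp1 (K : Type u) [Field K] (H : Type u) [Ring H] [Algebra K H] : H ≃ₐ[K] TP K H 1 :=
  (AlgEquiv.refl : H ≃ₐ[K] H)

/-- `H ⊗ H ≃ H^{⊗ 2}` -/
def tp2 (K : Type u) [Field K] (H : Type u) [Ring H] [Algebra K H] : H ⊗[K] H ≃ₐ[K] TP K H 2 :=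
  (AlgEquiv.refl : H ⊗[K] H ≃ₐ[K] H ⊗[K] H)

theorem slotP_last (n : ℕ) (h : H) :
    slotP K H (n + 2) (n + 1) h = tpE K H n (1 ⊗ₜ[K] h) := by
  simp [slotP]; rfl

theorem slotP_lt (n i : ℕ) (hi : i < n + 1) (h : H) :
    slotP K H (n + 2) i h = tpE K H n (slotP K H (n + 1) i h ⊗ₜ[K] (1 : H)) := by
  have : i ≠ n + 1 := by omega
  simp [slotP, this]; rfl

section
variable (αf βf : R → H)

theorem Idl_right (n : ℕ) (x y : TP K H n) (hx : x ∈ Idl K H αf βf n) :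
    x * y ∈ Idl K H αf βf n := by
  induction hx using Submodule.span_induction with
  | zero => simp
  | add x y _ _ hx hy => rw [add_mul]; exact add_mem hx hy
  | smul a x _ hx => rw [smul_mul_assoc]; exact Submodule.smul_mem _ _ hx
  | mem x hx =>
    obtain ⟨r, i, z, hi, rfl⟩ := hx
    exact Submodule.subset_span ⟨r, i, z * y, hi, mul_assoc _ _ _⟩

theorem Idl_one : Idl K H αf βf 1 = ⊥ := by
  refine Submodule.span_eq_bot.2 ?_
  rintro _ ⟨r, i, x, hi, rfl⟩
  omega

theorem relator_last (n : ℕ) (r : R) (a : TP K H (n + 1)) (b : H) :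
    relator K H αf βf (n + 2) r n * tpE K H n (a ⊗ₜ[K] b) =
      tpE K H n ((slotP K H (n + 1) n (βf r) * a) ⊗ₜ[K] b - a ⊗ₜ[K] (αf r * b)) := by
  rw [relator, slotP_last, slotP_lt _ _ (by omega), ← map_sub, ← map_mul, sub_mul,
    Algebra.TensorProduct.tmul_mul_tmul, Algebra.TensorProduct.tmul_mul_tmul,
    one_mul, one_mul]

theorem relator_lt (n i : ℕ) (hi : i < n) (r : R) (a : TP K H (n + 1)) (b : H) :
    relator K H αf βf (n + 2) r i * tpE K H n (a ⊗ₜ[K] b) =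
      tpE K H n ((relator K H αf βf (n + 1) r i * a) ⊗ₜ[K] b) := by
  rw [relator, slotP_lt _ _ (by omega), slotP_lt _ _ (by omega), ← map_sub, ← map_mul, sub_mul,
    Algebra.TensorProduct.tmul_mul_tmul, Algebra.TensorProduct.tmul_mul_tmul,
    one_mul, ← TensorProduct.sub_tmul, ← sub_mul]; rfl

theorem Idl_succ (n : ℕ) (x : TP K H (n + 1) ⊗[K] H) :
    tpE K H n x ∈ Idl K H αf βf (n + 2) ↔ x ∈
      nextI αf βf (slotP K H (n + 1) n) (Idl K H αf βf (n + 1)) := by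
  constructor
  · have : Idl K H αf βf (n + 2) ≤
        (nextI αf βf (slotP K H (n + 1) n) (Idl K H αf βf (n + 1))).map
          (tpE K H n).toLinearMap := by
      refine Submodule.span_le.2 ?_
      rintro _ ⟨r, i, x, hi, rfl⟩
      obtain ⟨x, rfl⟩ := (tpE K H n).surjective x
      induction x with
      | zero => rw [map_zero, mul_zero]; exact zero_mem _
      | add x y hx hy => rw [map_add, mul_add]; exact add_mem hx hy
      | tmul a b =>
        rcases Nat.lt_or_ge i n with h | h
        · rw [relator_lt _ _ _ _ h]
          exact Submodule.mem_map_of_mem (f := (tpE K H n).toLinearMap)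
            (Submodule.subset_span (Or.inl ⟨_, Submodule.subset_span ⟨r, i, a, by omega, rfl⟩,
              b, rfl⟩))
        · obtain rfl : i = n := by omega
          rw [relator_last]
          exact Submodule.mem_map_of_mem (f := (tpE K H i).toLinearMap)
            (Submodule.subset_span (Or.inr ⟨r, a, b, rfl⟩))
    intro hx
    obtain ⟨y, hy, hxy⟩ := this hx
    have := (tpE K H n).injective hxy
    rwa [← this]
  · intro hx
    induction hx using Submodule.span_induction with
    | zero => rw [map_zero]; exact zero_mem _
    | add x y _ _ hx hy => rw [map_add]; exact add_mem hx hy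
    | smul a x _ hx => rw [map_smul]; exact Submodule.smul_mem _ _ hx
    | mem x hx =>
      rcases hx with (⟨j, hj, b, rfl⟩ | ⟨r, a, b, rfl⟩)
      · induction hj using Submodule.span_induction with
        | zero => rw [TensorProduct.zero_tmul, map_zero]; exact zero_mem _
        | add x y _ _ hx hy => rw [TensorProduct.add_tmul, map_add]; exact add_mem hx hy
        | smul a x _ hx =>
          rw [← TensorProduct.smul_tmul', map_smul]; exact Submodule.smul_mem _ _ hx
        | mem x hx =>
          obtain ⟨r, i, a, hi, rfl⟩ := hx
          rw [← relator_lt _ _ _ _ (by omega)]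
          exact Submodule.subset_span ⟨r, i, _, by omega, rfl⟩
      · rw [← relator_last]
        exact Submodule.subset_span ⟨r, n, _, by omega, rfl⟩

theorem nextI_right (n : ℕ) (x y : TP K H (n + 1) ⊗[K] H)
    (h : x ∈ nextI αf βf (slotP K H (n + 1) n) (Idl K H αf βf (n + 1))) :
    x * y ∈ nextI αf βf (slotP K H (n + 1) n) (Idl K H αf βf (n + 1)) := by
  rw [← Idl_succ] at h ⊢
  rw [map_mul]
  exact Idl_right _ _ _ _ _ h

theorem Idl_two (x : H ⊗[K] H) : tp2 K H x ∈ Idl K H αf βf 2 ↔ x ∈ NN K αf βf := by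
  have h := Idl_succ αf βf 0 (x : H ⊗[K] H)
  have h2 := ker_next αf βf (slotP K H 1 0) (Idl K H αf βf 1)
    (Algebra.lmul K H) (tp1 K H).symm.toLinearMap (tp1 K H).symm.surjective (by
      intro x; rw [Idl_one]; simp) (fun r x => rfl) (x : H ⊗[K] H)
  refine h.trans (h2.symm.trans ?_)
  have : (tp1 K H).symm.toLinearMap.rTensor H x = x := LinearMap.rTensor_id_apply _ _ _
  exact iff_of_eq (congrArg (· ∈ NN K αf βf) this)

end
end Aux3
section Aux4
set_option linter.unusedSectionVars false

variable {K : Type u} [Field K] [CharZero K]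
variable {H : Type u} [Ring H] [Algebra K H]
variable {R : Type u} [Ring R] [Algebra K R]
variable {α : R →ₐ[K] H} {β : R →ₗ[K] H} (D : HopfAlgebroid K H R α β)

theorem exists_pres (t : H ⊗[K] H) :
    ∃ (C : ℕ) (u v : Fin C → H), t = ∑ c, u c ⊗ₜ[K] v c := by
  induction t with
  | zero => exact ⟨0, Fin.elim0, Fin.elim0, by simp⟩
  | tmul a b => exact ⟨1, fun _ => a, fun _ => b, by simp⟩
  | add x y hx hy =>
    obtain ⟨C, u, v, rfl⟩ := hx
    obtain ⟨C', u', v', rfl⟩ := hy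
    exact ⟨C + C', Fin.append u u', Fin.append v v', by simp [Fin.sum_univ_add]⟩

/-- the element `F` -/
def FF (K : Type u) [Field K] {H : Type u} [Ring H] [Algebra K H] {C : ℕ} (p q : Fin C → H) :
    H ⊗[K] H := ∑ c, p c ⊗ₜ[K] q c

/-- comparison of the quotients -/
def qE (αf βf : R → H) : QT K H αf βf 2 ≃ₗ[K] (H ⊗[K] H) ⧸ NN K αf βf :=
  Submodule.Quotient.equiv _ _ (tp2 K H).symm.toLinearEquiv (by
    ext x
    rw [← Idl_two]
    constructor
    · rintro ⟨y, hy, rfl⟩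
      simpa using hy
    · intro h
      exact ⟨_, h, by simp⟩)

theorem qE_mk (αf βf : R → H) (x : H ⊗[K] H) :
    qE αf βf (qtMk K H αf βf 2 (tp2 K H x)) = (NN K αf βf).mkQ x := by
  rfl

/-- coproduct -/
def Dl : H →ₗ[K] (H ⊗[K] H) ⧸ NN K (fun a => α a) (fun a => β a) :=
  (qE (fun a => α a) (fun a => β a)).toLinearMap ∘ₗ D.Δ

theorem Dl_iff (x : H) (s : H ⊗[K] H) :
    (NN K (fun a => α a) (fun a => β a)).mkQ s = Dl D x ↔
      qtMk K H (fun a => α a) (fun a => β a) 2 (tp2 K H s) = D.Δ x := by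
  rw [← qE_mk]
  exact (qE _ _).injective.eq_iff

theorem Dl_one : (NN K (fun a => α a) (fun a => β a)).mkQ 1 = Dl D 1 := by
  rw [Dl_iff, D.Δ_one, map_one]

theorem Dl_mul (x y : H) (s t : H ⊗[K] H)
    (hs : (NN K (fun a => α a) (fun a => β a)).mkQ s = Dl D x)
    (ht : (NN K (fun a => α a) (fun a => β a)).mkQ t = Dl D y) :
    (NN K (fun a => α a) (fun a => β a)).mkQ (s * t) = Dl D (x * y) := by
  rw [Dl_iff] at *
  rw [D.Δ_mul _ _ _ _ hs ht, map_mul]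

theorem slot20 (h : H) : slotP K H 2 0 h = tp2 K H (h ⊗ₜ 1) := by
  simp [slotP]; rfl

theorem slot21 (h : H) : slotP K H 2 1 h = tp2 K H (1 ⊗ₜ h) := by
  simp [slotP]; rfl

theorem Dl_nrm (x : H) (s : H ⊗[K] H)
    (hs : (NN K (fun a => α a) (fun a => β a)).mkQ s = Dl D x) :
    Nrm (fun a => α a) (fun a => β a) s := by
  rw [Dl_iff] at hs
  intro r
  have := D.Δ_compat x r _ hs
  rw [relator, slot20, slot21, ← map_sub, ← map_mul, Submodule.mkQ_apply,
    Submodule.Quotient.mk_eq_zero, Idl_two] at this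
  exact this

theorem Dl_bet' (r : R) (x : H) (s : H ⊗[K] H)
    (hs : (NN K (fun a => α a) (fun a => β a)).mkQ s = Dl D x) :
    (NN K (fun a => α a) (fun a => β a)).mkQ ((1 ⊗ₜ β r) * s) = Dl D (β r * x) := by
  rw [Dl_iff] at *
  rw [D.Δ_bimod_right r x _ hs, slot21, map_mul]

theorem Dl_bet (r : R) :
    (NN K (fun a => α a) (fun a => β a)).mkQ (1 ⊗ₜ β r) = Dl D (β r) := by
  simpa using Dl_bet' D r 1 1 (Dl_one D)

/-- `u ⊗ v ↦ β (ε (v w)) u` -/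
def kap (w : H) : H ⊗[K] H →ₗ[K] H :=
  TensorProduct.lift
    ((LinearMap.mul K H).comp (β.comp (D.ε.comp (LinearMap.mulRight K w)))).flip

theorem kap_tmul (w u v : H) : kap D w (u ⊗ₜ v) = β (D.ε (v * w)) * u := rfl

theorem kap_one (h : H) (t : H ⊗[K] H)
    (ht : (NN K (fun a => α a) (fun a => β a)).mkQ t = Dl D h) : kap D 1 t = h := by
  obtain ⟨C, u, v, rfl⟩ := exists_pres t
  rw [Dl_iff] at ht
  rw [map_sum, ← D.counit_right h C u v ht]
  simp [kap_tmul]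

theorem eps_mul (v w : H) : D.ε (v * β (D.ε w)) = D.ε (v * w) := by
  have h1 : D.ε (β (D.ε w) - w) = 0 := by
    have := D.ε_bimod_right (D.ε w) 1
    rw [mul_one, D.ε_one, one_mul] at this
    rw [map_sub, this, sub_self]
  have := D.ker_ε_ideal v _ h1
  rwa [mul_sub, map_sub, sub_eq_zero] at this

theorem kap_lift (w h : H) (t : H ⊗[K] H)
    (ht : (NN K (fun a => α a) (fun a => β a)).mkQ t = Dl D h) :
    kap D w t = h * β (D.ε w) := by
  rw [← kap_one D _ _ (Dl_mul D _ _ _ _ ht (Dl_bet D (D.ε w)))]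
  clear ht
  induction t with
  | zero => simp
  | add x y hx hy => rw [map_add, hx, hy, add_mul, map_add]
  | tmul a b =>
    rw [Algebra.TensorProduct.tmul_mul_tmul, kap_tmul, kap_tmul, mul_one, mul_one, eps_mul]

/-- `z ↦ 1 ⊗ β (z ▷ r)` -/
def gg (r : R) : H →ₗ[K] H ⊗[K] H :=
  (TensorProduct.mk K H H 1).comp (β.comp (D.ε.comp (LinearMap.mulRight K (α r))))

theorem gg_apply (r : R) (z : H) : gg D r z = 1 ⊗ₜ β (D.hAct z r) := rfl

/-- `x ⊗ y ⊗ z ↦ x ⊗ β (z ▷ r) y` -/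
def Psi (r : R) : (H ⊗[K] H) ⊗[K] H →ₗ[K] H ⊗[K] H :=
  TensorProduct.lift ((LinearMap.mul K (H ⊗[K] H)).comp (gg D r)).flip

theorem Psi_tmul (r : R) (w : H ⊗[K] H) (z : H) : Psi D r (w ⊗ₜ z) = gg D r z * w := rfl

/-- three tensor factors -/
def tp3 (K : Type u) [Field K] (H : Type u) [Ring H] [Algebra K H] :
    (H ⊗[K] H) ⊗[K] H ≃ₐ[K] TP K H 3 :=
  (AlgEquiv.refl : (H ⊗[K] H) ⊗[K] H ≃ₐ[K] (H ⊗[K] H) ⊗[K] H)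

theorem NN_left (D : HopfAlgebroid K H R α β) (a : R) (w : H ⊗[K] H) (hw : w ∈ NN K (fun a => α a) (fun a => β a)) :
    (1 ⊗ₜ β a) * w ∈ NN K (fun a => α a) (fun a => β a) := by
  induction hw using Submodule.span_induction with
  | zero => rw [mul_zero]; exact zero_mem _
  | add x y _ _ hx hy => rw [mul_add]; exact add_mem hx hy
  | smul c x _ hx => rw [mul_smul_comm]; exact Submodule.smul_mem _ _ hx
  | mem x hx =>
    obtain ⟨r, m, n, rfl⟩ := hx
    refine Submodule.subset_span ⟨r, m, β a * n, ?_⟩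
    have h : β a * (α r * n) = α r * (β a * n) := by
      rw [← mul_assoc, ← D.αβ_comm, mul_assoc]
    simp [mul_sub, h]

theorem Psi_Idl (r : R) (x : (H ⊗[K] H) ⊗[K] H)
    (hx : tp3 K H x ∈ Idl K H (fun a => α a) (fun a => β a) 3) :
    Psi D r x ∈ NN K (fun a => α a) (fun a => β a) := by
  have h1 : (TensorProduct.congr (tp2 K H).toLinearEquiv (LinearEquiv.refl K H) x) ∈
      nextI (fun a => α a) (fun a => β a) (slotP K H 2 1)
        (Idl K H (fun a => α a) (fun a => β a) 2) := by
    rw [← Idl_succ]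
    have : ∀ x : (H ⊗[K] H) ⊗[K] H,
        tpE K H 1 (TensorProduct.congr (tp2 K H).toLinearEquiv (LinearEquiv.refl K H) x)
        = tp3 K H x := by
      intro x
      induction x with
      | zero => simp
      | add x y hx hy => rw [map_add, map_add, hx, hy, map_add]
      | tmul a b => rfl
    rw [this]; exact hx
  generalize hy : (TensorProduct.congr (tp2 K H).toLinearEquiv (LinearEquiv.refl K H) x) = y at h1
  rw [← LinearEquiv.eq_symm_apply] at hy
  subst hy
  clear hx
  induction h1 using Submodule.span_induction with
  | zero => simp
  | add x y _ _ hx hy => rw [map_add, map_add]; exact add_mem hx hy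
  | smul c x _ hx => rw [map_smul, map_smul]; exact Submodule.smul_mem _ _ hx
  | mem x hx =>
    rcases hx with ⟨j, hj, b, rfl⟩ | ⟨a, w, b, rfl⟩
    · obtain ⟨j, rfl⟩ := (tp2 K H).surjective j
      rw [Idl_two] at hj
      have := NN_left D (D.hAct b r) j hj
      rw [TensorProduct.congr_symm_tmul, Psi_tmul, gg_apply]
      simpa using this
    · obtain ⟨w, rfl⟩ := (tp2 K H).surjective w
      rw [slot21, ← map_mul, map_sub, map_sub, TensorProduct.congr_symm_tmul,
        TensorProduct.congr_symm_tmul, Psi_tmul, Psi_tmul, gg_apply, gg_apply]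
      have h : D.hAct (α a * b) r = a * D.hAct b r := by
        simp only [HopfAlgebroid.hAct, mul_assoc, D.ε_bimod_left]
      simp only [LinearEquiv.refl_symm, LinearEquiv.refl_apply]
      rw [h, D.β_mul]
      have h2 : ∀ z, (tp2 K H).toLinearEquiv.symm (tp2 K H z) = z := fun z => rfl
      rw [h2, h2, ← mul_assoc, Algebra.TensorProduct.tmul_mul_tmul, one_mul, sub_self]
      exact zero_mem _

theorem Psi_assoc (r : R) (a y z h : H) (t : H ⊗[K] H)
    (ht : (NN K (fun a => α a) (fun a => β a)).mkQ t = Dl D h) :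
    Psi D r ((TensorProduct.assoc K H H H).symm (a ⊗ₜ t) *
      (TensorProduct.assoc K H H H).symm (1 ⊗ₜ (y ⊗ₜ z))) =
      a ⊗ₜ (h * (β (D.hAct z r) * y)) := by
  have : ∀ t : H ⊗[K] H, Psi D r ((TensorProduct.assoc K H H H).symm (a ⊗ₜ t) *
      (TensorProduct.assoc K H H H).symm (1 ⊗ₜ (y ⊗ₜ z))) =
      a ⊗ₜ (kap D (z * α r) t * y) := by
    intro t
    induction t with
    | zero => simp
    | add u v hu hv =>
      rw [TensorProduct.tmul_add, map_add, add_mul, map_add, hu, hv, map_add, add_mul,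
        TensorProduct.tmul_add]
    | tmul u v =>
      rw [TensorProduct.assoc_symm_tmul, TensorProduct.assoc_symm_tmul,
        Algebra.TensorProduct.tmul_mul_tmul, Psi_tmul, gg_apply,
        Algebra.TensorProduct.tmul_mul_tmul, Algebra.TensorProduct.tmul_mul_tmul, kap_tmul,
        HopfAlgebroid.hAct]
      simp [mul_assoc]
  rw [this, kap_lift D _ h t ht, mul_assoc]
  rfl

theorem key {C : ℕ} (p q : Fin C → H) (htw : IsTwistor D p q) (r : R) (s : H ⊗[K] H)
    (hs : (NN K (fun a => α a) (fun a => β a)).mkQ s = Dl D (betaF D p q r)) :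
    (NN K (fun a => α a) (fun a => β a)).mkQ (s * FF K p q) =
      (NN K (fun a => α a) (fun a => β a)).mkQ (FF K p q * (1 ⊗ₜ betaF D p q r)) := by
  obtain ⟨⟨s', t', hs', ht', h1⟩, -, -⟩ := htw
  let S : Fin C → H ⊗[K] H := fun c => (tp2 K H).symm (s' c)
  let T : Fin C → H ⊗[K] H := fun c => (tp2 K H).symm (t' c)
  have hS : ∀ c, (NN K (fun a => α a) (fun a => β a)).mkQ (S c) = Dl D (p c) := by
    intro c; rw [Dl_iff]; simpa [S] using hs' c
  have hT : ∀ c, (NN K (fun a => α a) (fun a => β a)).mkQ (T c) = Dl D (q c) := by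
    intro c; rw [Dl_iff]; simpa [T] using ht' c
  have h2 : qtMk K H (fun a => α a) (fun a => β a) 3
      (tp3 K H ((∑ c, S c ⊗ₜ[K] q c) * (∑ c, (p c ⊗ₜ[K] q c) ⊗ₜ[K] (1 : H)))) =
    qtMk K H (fun a => α a) (fun a => β a) 3
      (tp3 K H ((∑ c, (TensorProduct.assoc K H H H).symm (p c ⊗ₜ[K] T c)) *
        (∑ c, (TensorProduct.assoc K H H H).symm ((1 : H) ⊗ₜ[K] (p c ⊗ₜ[K] q c))))) := h1
  rw [← sub_eq_zero, ← map_sub, ← map_sub, Submodule.mkQ_apply,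
    Submodule.Quotient.mk_eq_zero] at h2
  have h3 := Psi_Idl D r _ h2
  rw [map_sub] at h3
  have hX : Psi D r ((∑ c, S c ⊗ₜ[K] q c) * (∑ c, (p c ⊗ₜ[K] q c) ⊗ₜ[K] (1 : H))) =
      (∑ c, gg D r (q c) * S c) * FF K p q := by
    rw [← TensorProduct.sum_tmul, Finset.sum_mul, map_sum, Finset.sum_mul]
    refine Finset.sum_congr rfl fun c _ => ?_
    rw [Algebra.TensorProduct.tmul_mul_tmul, Psi_tmul, mul_one, mul_assoc]; rfl
  have hY : Psi D r ((∑ c, (TensorProduct.assoc K H H H).symm (p c ⊗ₜ[K] T c)) *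
        (∑ c, (TensorProduct.assoc K H H H).symm ((1 : H) ⊗ₜ[K] (p c ⊗ₜ[K] q c)))) =
      FF K p q * (1 ⊗ₜ betaF D p q r) := by
    rw [Finset.sum_mul_sum, map_sum, FF, Finset.sum_mul]
    refine Finset.sum_congr rfl fun c _ => ?_
    rw [map_sum, Algebra.TensorProduct.tmul_mul_tmul, mul_one, betaF, Finset.mul_sum,
      TensorProduct.tmul_sum]
    refine Finset.sum_congr rfl fun c' _ => ?_
    rw [Psi_assoc D r _ _ _ _ _ (hT c)]
  rw [hX, hY] at h3
  have hL : (NN K (fun a => α a) (fun a => β a)).mkQ (∑ c, gg D r (q c) * S c) =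
      Dl D (betaF D p q r) := by
    rw [betaF, map_sum, map_sum]
    refine Finset.sum_congr rfl fun c _ => ?_
    rw [gg_apply, Dl_bet' D _ _ _ (hS c)]
  have h5 : (NN K (fun a => α a) (fun a => β a)).mkQ (s * FF K p q) =
      (NN K (fun a => α a) (fun a => β a)).mkQ ((∑ c, gg D r (q c) * S c) * FF K p q) := by
    rw [← sub_eq_zero, ← map_sub, ← sub_mul, Submodule.mkQ_apply, Submodule.Quotient.mk_eq_zero]
    apply modRel_right
    rw [← Submodule.Quotient.mk_eq_zero, ← Submodule.mkQ_apply, map_sub, hs, hL, sub_self]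
  rw [h5, ← sub_eq_zero, ← map_sub, Submodule.mkQ_apply, Submodule.Quotient.mk_eq_zero]
  exact h3

theorem Th_FF {C : ℕ} (p q : Fin C → H) {M N : Type u} [AddCommGroup M] [Module K M]
    [AddCommGroup N] [Module K N]
    (ρ₁ : H →ₐ[K] Module.End K M) (ρ₂ : H →ₐ[K] Module.End K N) (w : M ⊗[K] N) :
    Th ρ₁ ρ₂ (FF K p q) w = ∑ c, TensorProduct.map (ρ₁ (p c)) (ρ₂ (q c)) w := by
  rw [FF, map_sum, LinearMap.sum_apply]
  simp only [Th_map]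

/-- the abstract package -/
def theBi {C : ℕ} (p q : Fin C → H) (htw : IsTwistor D p q) :
    Bi (fun a => α a) (fun a => β a) (alphaF D p q) (betaF D p q) (FF K p q) where
  Δ := Dl D
  one := Dl_one D
  mul := Dl_mul D
  nrm := Dl_nrm D
  bet := Dl_bet D
  betF := key D p q htw
  inj M _ _ ρ w := by
    obtain ⟨G, hG, hb⟩ := htw.2.2 M H ρ (Algebra.lmul K H)
    rw [Th_FF, ← Submodule.Quotient.mk_eq_zero, ← hG, map_eq_zero_iff G hb.1,
      Submodule.Quotient.mk_eq_zero]
  sur M _ _ ρ w := by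
    obtain ⟨G, hG, hb⟩ := htw.2.2 M H ρ (Algebra.lmul K H)
    obtain ⟨y, hy⟩ := hb.2 (Submodule.Quotient.mk w)
    obtain ⟨w', rfl⟩ := Submodule.mkQ_surjective _ y
    refine ⟨w', ?_⟩
    rw [Th_FF]
    exact (hG w').symm.trans hy

end Aux4
section Aux5
set_option linter.unusedSectionVars false

variable {K : Type u} [Field K] [CharZero K]
variable {H : Type u} [Ring H] [Algebra K H]
variable {R : Type u} [Ring R] [Algebra K R]
variable {α : R →ₐ[K] H} {β : R →ₗ[K] H} (D : HopfAlgebroid K H R α β)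
variable {C : ℕ} (p q : Fin C → H) (htw : IsTwistor D p q)

/-- level zero -/
def lev0 : Lev (fun a => β a) (betaF D p q) (TP K H 1) (slotP K H 1 0)
    (Idl K H (fun a => α a) (fun a => β a) 1) (Idl K H (alphaF D p q) (betaF D p q) 1) where
  M := H
  ρ := Algebra.lmul K H
  π := (tp1 K H).symm.toLinearMap
  e := 1
  surj := (tp1 K H).symm.surjective
  ker x := by rw [Idl_one]; simp
  right x y h := by
    have : x = 0 := by simpa using h
    simp [this]
  act h s x hs := by
    have : (tp1 K H).symm s = h := by simpa using hs
    simp [this]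
  bet r x := rfl
  surjF y := ⟨tp1 K H y, by simp⟩
  kerF x := by rw [Idl_one]; simp
  betF r x := by rw [one_mul, one_mul]; rfl

/-- the levels -/
def lev : ∀ n : ℕ, Lev (fun a => β a) (betaF D p q) (TP K H (n + 1)) (slotP K H (n + 1) n)
    (Idl K H (fun a => α a) (fun a => β a) (n + 1))
    (Idl K H (alphaF D p q) (betaF D p q) (n + 1))
  | 0 => lev0 D p q
  | (n + 1) => ((lev n).next (theBi D p q htw) (fun h => 1 ⊗ₜ h) (fun _ => rfl) _ _ rfl rfl
      (nextI_right _ _ n)).transport (tpE K H n) (slotP K H (n + 2) (n + 1)) (slotP_last n) _ _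
      (Idl_succ _ _ n) (Idl_succ _ _ n)

theorem lev_π (n : ℕ) (x : TP K H (n + 1) ⊗[K] H) :
    @Eq ((lev D p q htw n).M' (fun a => α a)) ((lev D p q htw (n + 1)).π (tpE K H n x))
      ((lev D p q htw n).π' (fun a => α a) x) := rfl

theorem lev_ρ (n : ℕ) (h : H) (w : (lev D p q htw n).M' (fun a => α a)) :
    @Eq ((lev D p q htw n).M' (fun a => α a)) ((lev D p q htw (n + 1)).ρ h w)
      ((theBi D p q htw).rho (lev D p q htw n).ρ (Algebra.lmul K H) h w) := rfl

theorem lev_e (n : ℕ) : (lev D p q htw (n + 1)).e =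
    tpE K H n ((lev D p q htw n).e' (fun a => α a) (FF K p q)) := rfl

theorem lev_πe (n : ℕ) (x : TP K H (n + 1) ⊗[K] H) :
    @Eq ((lev D p q htw n).M' (fun a => α a)) ((lev D p q htw (n + 1)).π
        ((lev D p q htw (n + 1)).e * tpE K H n x))
      ((modRel K (fun a => α a) (fun a => β a) (lev D p q htw n).ρ (Algebra.lmul K H)).mkQ
      (Th (lev D p q htw n).ρ (Algebra.lmul K H) (FF K p q)
        ((lev D p q htw n).πe.rTensor H x))) := by
  rw [lev_e, ← map_mul, lev_π, Lev.e'_mul _ _ (nextI_right _ _ n)]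

theorem lev_ρe (n : ℕ) (x : H) (s : H ⊗[K] H)
    (hs : (NN K (fun a => α a) (fun a => β a)).mkQ s = (theBi D p q htw).Δ x) :
    @Eq ((lev D p q htw n).M' (fun a => α a))
      ((lev D p q htw (n + 1)).ρ x ((lev D p q htw (n + 1)).π (lev D p q htw (n + 1)).e))
      ((modRel K (fun a => α a) (fun a => β a) (lev D p q htw n).ρ (Algebra.lmul K H)).mkQ
      (Th (lev D p q htw n).ρ (Algebra.lmul K H) s
      (Th (lev D p q htw n).ρ (Algebra.lmul K H) (FF K p q)
        ((lev D p q htw n).πe.rTensor H 1)))) := by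
  have h3 := lev_πe D p q htw n 1
  rw [map_one, mul_one] at h3
  refine (lev_ρ D p q htw n x ((lev D p q htw (n + 1)).π (lev D p q htw (n + 1)).e)).trans ?_
  exact (congrArg ((theBi D p q htw).rho (lev D p q htw n).ρ (Algebra.lmul K H) x) h3).trans
    (Bi.rho_spec _ _ _ x s hs _)

theorem lev_mk (n : ℕ) (x y : TP K H (n + 1)) :
    (lev D p q htw n).π x = (lev D p q htw n).π y ↔
      qmk K H α β (n + 1) x = qmk K H α β (n + 1) y := by
  rw [← sub_eq_zero, ← map_sub, (lev D p q htw n).ker, ← Submodule.Quotient.mk_eq_zero,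
    Submodule.Quotient.mk_sub, sub_eq_zero]; rfl

theorem lev_mkF (n : ℕ) (x y : TP K H (n + 1)) :
    (lev D p q htw n).πe x = (lev D p q htw n).πe y ↔
      qtMk K H (alphaF D p q) (betaF D p q) (n + 1) x =
        qtMk K H (alphaF D p q) (betaF D p q) (n + 1) y := by
  rw [← sub_eq_zero, ← map_sub, Lev.πe_apply, (lev D p q htw n).kerF,
    ← Submodule.Quotient.mk_eq_zero, Submodule.Quotient.mk_sub, sub_eq_zero]; rfl

theorem lev_pow (n : ℕ) : ∀ (x : H) (s : TP K H (n + 1)), qmk K H α β (n + 1) s = D.Δpow n x →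
    (lev D p q htw n).π s = (lev D p q htw n).ρ x ((lev D p q htw n).π 1) := by
  induction n with
  | zero =>
    intro x s hs
    rw [D.Δpow_zero] at hs
    have h1 := (lev_mk D p q htw 0 s x).2 hs
    rw [h1]
    exact (mul_one x).symm
  | succ n ih =>
    intro x s hs
    have hl := (theBi D p q htw).lift_spec x
    obtain ⟨C', u, v, h⟩ := exists_pres ((theBi D p q htw).lift x)
    have hl2 := (Dl_iff D x _).1 hl
    choose t ht using fun c => Submodule.mkQ_surjective _ (D.Δpow n (u c))
    have h2 := D.Δpow_succ n x C' u v (by rw [← hl2, h]; rfl) t ht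
    have h3 := (lev_mk D p q htw (n + 1) s (tpE K H n (∑ c, t c ⊗ₜ v c))).2 (hs.trans h2)
    rw [h3]
    rw [← map_one (tpE K H n)]
    refine (lev_π D p q htw n _).trans ?_
    refine Eq.trans ?_ (lev_ρ D p q htw n x ((lev D p q htw n).π' (fun a => α a) 1)).symm
    rw [Lev.π'_apply, Lev.π'_apply, Bi.rho_spec _ _ _ x _ hl, h]
    congr 1
    rw [map_sum, map_sum, LinearMap.sum_apply]
    refine Finset.sum_congr rfl fun c _ => ?_
    rw [Algebra.TensorProduct.one_def, LinearMap.rTensor_tmul, LinearMap.rTensor_tmul, Th_tmul,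
      ih _ _ (ht c)]
    simp

/-- twisted comparison -/
def Phi (n : ℕ) : QT K H (alphaF D p q) (betaF D p q) (n + 1) ≃ₗ[K] (lev D p q htw n).M :=
  LinearEquiv.ofBijective
    ((Idl K H (alphaF D p q) (betaF D p q) (n + 1)).liftQ (lev D p q htw n).πe
      (fun x hx => ((lev D p q htw n).kerF x).2 hx))
    ⟨by
      intro a b h
      obtain ⟨a, rfl⟩ := Submodule.mkQ_surjective _ a
      obtain ⟨b, rfl⟩ := Submodule.mkQ_surjective _ b
      exact (lev_mkF D p q htw n a b).1 h,
     by
      intro y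
      obtain ⟨x, hx⟩ := (lev D p q htw n).surjF y
      exact ⟨Submodule.mkQ _ x, hx⟩⟩

/-- untwisted comparison -/
def Psi' (n : ℕ) : QT K H (fun a => α a) (fun a => β a) (n + 1) ≃ₗ[K] (lev D p q htw n).M :=
  LinearEquiv.ofBijective
    ((Idl K H (fun a => α a) (fun a => β a) (n + 1)).liftQ (lev D p q htw n).π
      (fun x hx => ((lev D p q htw n).ker x).2 hx))
    ⟨by
      intro a b h
      obtain ⟨a, rfl⟩ := Submodule.mkQ_surjective _ a
      obtain ⟨b, rfl⟩ := Submodule.mkQ_surjective _ b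
      exact (lev_mk D p q htw n a b).1 h,
     by
      intro y
      obtain ⟨x, hx⟩ := (lev D p q htw n).surj y
      exact ⟨Submodule.mkQ _ x, hx⟩⟩

theorem Phi_mk (n : ℕ) (x : TP K H (n + 1)) :
    Phi D p q htw n (qtMk K H (alphaF D p q) (betaF D p q) (n + 1) x) =
      (lev D p q htw n).π ((lev D p q htw n).e * x) := rfl

theorem Psi'_mk (n : ℕ) (x : TP K H (n + 1)) :
    Psi' D p q htw n (qmk K H α β (n + 1) x) = (lev D p q htw n).π x := rfl

/-- the elements `e` -/
def ee : ∀ n : ℕ, TP K H n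
  | 0 => 1
  | (n + 1) => (lev D p q htw n).e

/-- the map -/
def Fss : ∀ n : ℕ, PH K H (alphaF D p q) (betaF D p q) n →ₗ[K]
          PH K H (fun a => α a) (fun a => β a) n
  | 0 => (LinearMap.id : R →ₗ[K] R)
  | (n + 1) => ((Psi' D p q htw n).symm.toLinearMap ∘ₗ (Phi D p q htw n).toLinearMap :
      QT K H (alphaF D p q) (betaF D p q) (n + 1) →ₗ[K]
        QT K H (fun a => α a) (fun a => β a) (n + 1))

/-- twisted iterated coproducts -/
def dpF (n : ℕ) : H →ₗ[K] QT K H (alphaF D p q) (betaF D p q) (n + 1) :=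
  (Phi D p q htw n).symm.toLinearMap ∘ₗ
    ((LinearMap.applyₗ ((lev D p q htw n).π (lev D p q htw n).e)).comp
      (lev D p q htw n).ρ.toLinearMap)

theorem Phi_dpF (n : ℕ) (x : H) : Phi D p q htw n (dpF D p q htw n x) =
    (lev D p q htw n).ρ x ((lev D p q htw n).π (lev D p q htw n).e) :=
  (Phi D p q htw n).apply_symm_apply _

theorem Fss_eq (n : ℕ) (x : QT K H (alphaF D p q) (betaF D p q) (n + 1)) (y : TP K H (n + 1))
    (h : Phi D p q htw n x = (lev D p q htw n).π y) :
    Fss D p q htw (n + 1) x = qmk K H α β (n + 1) y :=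
  (LinearEquiv.symm_apply_eq _).2 h

theorem chain_snoc (n : ℕ) (Z : Fin (n + 1) → H) (z : H) :
    chainP K H (n + 2) (Fin.snoc Z z) = tpE K H n (chainP K H (n + 1) Z ⊗ₜ z) := by
  rw [chainP, List.ofFn_succ', List.prod_concat]
  simp only [Fin.snoc_castSucc, Fin.snoc_last, Fin.val_castSucc, Fin.val_last]
  rw [slotP_last]
  let f : TP K H (n + 1) →ₐ[K] TP K H (n + 2) := (tpE K H n).toAlgHom.comp
    (Algebra.TensorProduct.includeLeft (R := K) (S := K) (A := TP K H (n + 1)) (B := H))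
  have hf : ∀ x, f x = tpE K H n (x ⊗ₜ 1) := fun x => rfl
  have h1 : ∀ i : Fin (n + 1), slotP K H (n + 2) i (Z i) = f (slotP K H (n + 1) i (Z i)) :=
    fun i => slotP_lt n i i.2 (Z i)
  simp only [h1]
  have h2 : (List.ofFn fun i : Fin (n + 1) => f (slotP K H (n + 1) i (Z i))).prod =
      f (chainP K H (n + 1) Z) := by
    rw [chainP, map_list_prod, List.map_ofFn]; rfl
  rw [h2, hf, ← map_mul, Algebra.TensorProduct.tmul_mul_tmul, mul_one, one_mul]

theorem isE3 (n : ℕ) (CP : Fin C → ℕ) (ZP : (c : Fin C) → Fin (CP c) → Fin (n + 1) → H)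
    (hZ : ∀ c, qmk K H α β (n + 1) (∑ d, chainP K H (n + 1) (ZP c d)) = D.Δpow n (p c)) :
    qmk K H α β (n + 2) (ee D p q htw (n + 2)) =
      qmk K H α β (n + 2)
        ((∑ c, ∑ d : Fin (CP c), chainP K H (n + 2) (Fin.snoc (ZP c d) (q c))) *
          (tpE K H n (ee D p q htw (n + 1) ⊗ₜ[K] (1 : H)))) := by
  rw [← lev_mk D p q htw (n + 1)]
  simp only [chain_snoc, ← map_sum, ← TensorProduct.sum_tmul, ← map_mul]
  refine Eq.trans ?_ (lev_π D p q htw n _).symm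
  refine (lev_π D p q htw n ((lev D p q htw n).e' (fun a => α a) (FF K p q))).trans ?_
  rw [Lev.e'_spec, Lev.π'_apply]
  congr 1
  rw [FF, map_sum, LinearMap.sum_apply, Finset.sum_mul, map_sum]
  refine Finset.sum_congr rfl fun c _ => ?_
  rw [Th_tmul, Algebra.TensorProduct.tmul_mul_tmul, LinearMap.rTensor_tmul,
    (lev D p q htw n).act (p c) _ _ (lev_pow D p q htw n _ _ (hZ c))]
  rfl

theorem isE : IsEChain D p q (ee D p q htw) := by
  refine ⟨rfl, ?_, fun n CP ZP hZ => isE3 D p q htw n CP ZP hZ⟩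
  have hc : ∀ c, chainP K H 1 (fun _ => p c) = tp1 K H (p c) := fun c => by
    rw [chainP, List.ofFn_succ, List.ofFn_zero, List.prod_singleton]; rfl
  rw [isE3 D p q htw 0 (fun _ => 1) (fun c _ _ => p c)
    (fun c => by rw [D.Δpow_zero]; simp [hc]; rfl)]
  congr 1
  have h1 : tpE K H 0 (ee D p q htw 1 ⊗ₜ[K] (1 : H)) = 1 := rfl
  rw [h1, mul_one]
  refine Finset.sum_congr rfl fun c _ => ?_
  rw [Fin.sum_univ_one, chain_snoc, hc]; rfl

theorem dpF_NN (x : H) (w : H ⊗[K] H)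
    (h : qtMk K H (alphaF D p q) (betaF D p q) 2 (tp2 K H w) = dpF D p q htw 1 x)
    (s : H ⊗[K] H) (hs : (NN K (fun a => α a) (fun a => β a)).mkQ s = Dl D x) :
    (NN K (fun a => α a) (fun a => β a)).mkQ (FF K p q * w) =
      (NN K (fun a => α a) (fun a => β a)).mkQ (s * FF K p q) := by
  have h1 := congrArg (Phi D p q htw 1) h
  rw [Phi_dpF, Phi_mk] at h1
  have hT : ∀ t w : H ⊗[K] H, Th (Algebra.lmul K H) (Algebra.lmul K H) t w = t * w := by
    intro t w
    induction t with
    | zero => simp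
    | add a b ha hb => rw [map_add, LinearMap.add_apply, ha, hb, add_mul]
    | tmul a b =>
      induction w with
      | zero => simp
      | add x y hx hy => rw [map_add, hx, hy, mul_add]
      | tmul x y => rw [Th_tmul]; simp
  have hE : ∀ w : TP K H 1 ⊗[K] H, (lev D p q htw 0).πe.rTensor H w = w := by
    intro w
    induction w with
    | zero => rw [map_zero]; rfl
    | add x y hx hy => rw [map_add, hx, hy]; rfl
    | tmul x y => rw [LinearMap.rTensor_tmul, Lev.πe_apply]; exact congrArg (· ⊗ₜ y) (one_mul x)
  have h2 := (lev_πe D p q htw 0 (w : H ⊗[K] H)).symm.trans h1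
  have h4 := lev_ρe D p q htw 0 x s hs
  have h5 := h2.trans h4
  rw [hE] at h5
  have h6 : (NN K (fun a => α a) (fun a => β a)).mkQ
      (Th (Algebra.lmul K H) (Algebra.lmul K H) (FF K p q) w) =
    (NN K (fun a => α a) (fun a => β a)).mkQ (Th (Algebra.lmul K H) (Algebra.lmul K H) s
      (Th (Algebra.lmul K H) (Algebra.lmul K H) (FF K p q) 1)) :=
    (congrArg (fun z : H ⊗[K] H => (NN K (fun a => α a) (fun a => β a)).mkQ
      (Th (Algebra.lmul K H) (Algebra.lmul K H) (FF K p q) z)) (hE w)).symm.trans h5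
  rw [hT, hT, hT, mul_one] at h6
  exact h6

theorem isIter : IsIteratedOn (alphaF D p q) (betaF D p q) (dpF D p q htw 1)
    (dpF D p q htw) := by
  refine ⟨?_, rfl, ?_⟩
  · intro x
    apply (Phi D p q htw 0).injective
    rw [Phi_dpF]
    refine Eq.trans ?_ (Phi_mk D p q htw 0 x).symm
    exact (mul_one x).trans (one_mul x).symm
  · intro n x C' u v h s hs
    have hl := (theBi D p q htw).lift_spec x
    have h1 := dpF_NN D p q htw x (∑ c, u c ⊗ₜ v c) h _ hl
    apply (Phi D p q htw (n + 1)).injective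
    rw [Phi_dpF]
    refine Eq.trans ?_ (Phi_mk D p q htw (n + 1) (tpE K H n (∑ c, s c ⊗ₜ v c))).symm
    refine Eq.trans ?_ (lev_πe D p q htw n _).symm
    have h4 := lev_ρe D p q htw n x _ hl
    rw [← Module.End.mul_apply, ← map_mul,
      ← Bi.mk_Th_congr _ _ _ _ h1, map_mul, Module.End.mul_apply] at h4
    refine h4.trans ?_
    congr 2
    rw [map_sum, map_sum, LinearMap.sum_apply]
    refine Finset.sum_congr rfl fun c _ => ?_
    have h5 := congrArg (Phi D p q htw n) (hs c)
    rw [Phi_dpF, Phi_mk] at h5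
    rw [Algebra.TensorProduct.one_def, LinearMap.rTensor_tmul, LinearMap.rTensor_tmul, Th_tmul,
      Lev.πe_apply, Lev.πe_apply, h5, mul_one]
    simp

end Aux5
/-! ### STATEMENT 13 -/

/-- **`F♯` of the twisted iterated coproducts.**
Let `F = Σ_c (p c) ⊗_R (q c)` be a twistor of the Hopf algebroid `H` and let
`H_F = (H, α_F, β_F, ·, Δ_F, ε)` be the twisted Hopf algebroid over `R_F`, with
`Δ_F(x) = (F♯)⁻¹(Δ(x) · F)`.  For every `k ≥ 2` (below: `k + 2`) and every `h ∈ H`,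
`F♯(Δ_F^{k−1}(h)) = (Δ^{k−1}h) · E_k` in `H^{⊗_R k}`, where
`E_k = F♯(1 ⊗_{R_F} ⋯ ⊗_{R_F} 1)` and `·` denotes the insertion action. -/
theorem FSharp_of_twisted_coproduct
    (K : Type u) [Field K] [CharZero K]
    (H : Type u) [Ring H] [Algebra K H]
    (R : Type u) [Ring R] [Algebra K R]
    (α : R →ₐ[K] H) (β : R →ₗ[K] H)
    (D : HopfAlgebroid K H R α β)
    (C : ℕ) (p q : Fin C → H) (htw : IsTwistor D p q) :
    ∃ (e : ∀ n : ℕ, TP K H n)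
      (Fs : ∀ n : ℕ, PH K H (alphaF D p q) (betaF D p q) n →ₗ[K]
          PH K H (fun a => α a) (fun a => β a) n)
      (ΔF : H →ₗ[K] QT K H (alphaF D p q) (betaF D p q) 2)
      (ΔpF : ∀ n : ℕ, H →ₗ[K] QT K H (alphaF D p q) (betaF D p q) (n + 1)),
      IsEChain D p q e ∧ IsFSharp D p q e Fs ∧
      -- `Δ_F(x) = (F♯)⁻¹(Δ(x) · F)`
      (∀ (x : H) (s : TP K H 2), qmk K H α β 2 s = D.Δ x →
        Fs 2 (ΔF x) = qmk K H α β 2 (s * (show TP K H 2 from ∑ c, p c ⊗ₜ[K] q c))) ∧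
      -- `Δ_F^n` are the iterated coproducts of `Δ_F`
      IsIteratedOn (alphaF D p q) (betaF D p q) ΔF ΔpF ∧
      -- `E_k = F♯(1 ⊗_{R_F} ⋯ ⊗_{R_F} 1)`
      (∀ k : ℕ, Fs (k + 1) (qtMk K H (alphaF D p q) (betaF D p q) (k + 1) 1) =
        qmk K H α β (k + 1) (e (k + 1))) ∧
      -- the main identity: `F♯(Δ_F^{k−1}(h)) = (Δ^{k−1}h) · E_k` for `k ≥ 2`
      (∀ (k : ℕ) (h : H) (s : TP K H (k + 2)),
        qmk K H α β (k + 2) s = D.Δpow (k + 1) h →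
        Fs (k + 2) (ΔpF (k + 1) h) = qmk K H α β (k + 2) (s * e (k + 2))) := by
  refine ⟨ee D p q htw, Fss D p q htw, dpF D p q htw 1, dpF D p q htw, isE D p q htw, ?_, ?_,
    isIter D p q htw, ?_, ?_⟩
  · exact ⟨fun a => rfl, fun n x => Fss_eq D p q htw n _ _ (Phi_mk D p q htw n _)⟩
  · intro x s hs
    refine Fss_eq D p q htw 1 _ _ ?_
    rw [Phi_dpF]
    have h1 := lev_pow D p q htw 1 x s (by rw [D.Δpow_one]; exact hs)
    have h2 := (isE D p q htw).2.1
    have h3 := (lev_mk D p q htw 1 _ _).2 h2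
    refine (congrArg ((lev D p q htw 1).ρ x) h3).trans ?_
    exact (lev D p q htw 1).act x s _ h1
  · intro k
    refine Fss_eq D p q htw k _ _ ?_
    rw [Phi_mk, mul_one]
    rfl
  · intro k h s hs
    refine Fss_eq D p q htw (k + 1) _ _ ?_
    rw [Phi_dpF]
    exact (lev D p q htw (k + 1)).act h s _ (lev_pow D p q htw (k + 1) h s hs)
end
end

section
/- Let (H, α, β, ·, Δ, ε) be a Hopf algebroid over R, F a twistor of H, and H_F the twisted Hopf algebroid over R_F with coproduct Δ_F(x) := (F♯)^{−1}(Δ(x)·F). Then for every integer k ≥ 1, every h ∈ H, and every u ∈ H^{⊗_{R_F} k}, one has F♯((Δ_F^{k−1}h) · u) = (Δ^{k−1}h) · (F♯ u) in H^{⊗_R k}, where on the left the insertion action is that of the twisted Hopf algebroid H_F and on the right that of H. -/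
/-! # Preliminaries: Hopf algebroids in the sense of Xu

We fix a field `K` of characteristic zero, an associative unital `K`-algebra `R` and an
associative unital `K`-algebra `H`.  We construct the `n`-fold tensor powers
`H^{⊗_K n}` of `H` over `K` and, given source and target maps `α, β : R → H`, the
quotients `H^{⊗_R n}` of `H^{⊗_K n}` by the right ideal `I_n` generated by the elements
`1 ⊗ ⋯ ⊗ β(r) ⊗ 1 ⊗ ⋯ ⊗ 1 − 1 ⊗ ⋯ ⊗ 1 ⊗ α(r) ⊗ ⋯ ⊗ 1`.

A Hopf algebroid is then given by the data `(H, α, β, ·, Δ, ε)` subject to the axioms of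
Xu; the iterated coproducts `Δⁿ = (Δ^{n−1} ⊗_R id) ∘ Δ` are part of the data, uniquely
characterized by their recursion.  All axioms involving maps induced on the quotients
`H^{⊗_R n}` are stated equivalently in terms of (arbitrary) lifts along the quotient
maps and (arbitrary) presentations of elements as sums of pure tensors. -/

noncomputable section

open scoped TensorProduct

universe u

variable (K : Type u) [Field K] [CharZero K]

variable (H : Type u) [Ring H] [Algebra K H]

variable {R : Type u} [Ring R] [Algebra K R]

variable (R)

set_option linter.unusedSectionVars false
set_option linter.unusedVariables false
set_option linter.style.longLine false

namespace FSI
section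
variable {K : Type u} [Field K] [CharZero K]
variable {H : Type u} [Ring H] [Algebra K H]
variable {R : Type u} [Ring R] [Algebra K R]

/-- tensoring on the right -/
def tm (n : ℕ) : TP K H (n+1) →ₗ[K] H →ₗ[K] TP K H (n+2) :=
  TensorProduct.mk K (TP K H (n+1)) H

theorem tm_mul (n : ℕ) (a b : TP K H (n+1)) (x y : H) :
    tm n a x * tm n b y = tm n (a * b) (x * y) :=
  Algebra.TensorProduct.tmul_mul_tmul a b x y

theorem tm_one (n : ℕ) : tm (K := K) (H := H) n 1 1 = 1 := rfl

theorem tm_ind (n : ℕ) {P : TP K H (n+2) → Prop} (w : TP K H (n+2))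
    (h1 : ∀ a x, P (tm n a x)) (h2 : ∀ a b, P a → P b → P (a + b)) : P w := by
  refine TensorProduct.induction_on (motive := fun w => P w) w ?_ h1 h2
  have := h1 0 0
  rwa [map_zero] at this

theorem slot_last (n : ℕ) (h : H) : slotP K H (n+2) (n+1) h = tm n 1 h := by
  unfold slotP; exact if_pos rfl

theorem slot_lt (n i : ℕ) (hi : i ≠ n + 1) (h : H) :
    slotP K H (n+2) i h = tm n (slotP K H (n+1) i h) 1 := by
  rw [slotP]; exact if_neg hi

theorem list_tm (n : ℕ) (l : List (TP K H (n+1))) :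
    (l.map (fun a => tm n a (1 : H))).prod = tm n l.prod 1 := by
  induction l with
  | nil => rfl
  | cons a l ih => rw [List.map_cons, List.prod_cons, ih, tm_mul, List.prod_cons, mul_one]

theorem chain_snoc (n : ℕ) (z : Fin (n+1) → H) (y : H) :
    chainP K H (n+2) (Fin.snoc z y) = tm n (chainP K H (n+1) z) y := by
  unfold chainP
  rw [List.ofFn_succ', List.concat_eq_append, List.prod_append, List.prod_singleton]
  have h1 : (List.ofFn fun i : Fin (n+1) =>
      slotP K H (n+2) ((i.castSucc : Fin (n+2)) : ℕ) ((Fin.snoc z y : Fin (n+2) → H) i.castSucc))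
      = (List.ofFn fun i : Fin (n+1) => slotP K H (n+1) i (z i)).map (fun a => tm n a (1 : H)) := by
    rw [List.map_ofFn]
    congr 1
    funext i
    have := i.isLt
    simp only [Fin.snoc_castSucc, Fin.val_castSucc, Function.comp]
    exact slot_lt n i (by omega) _
  have h2 : slotP K H (n+2) ((Fin.last (n+1) : Fin (n+2)) : ℕ)
      ((Fin.snoc z y : Fin (n+2) → H) (Fin.last (n+1))) = tm n 1 y := by
    rw [Fin.snoc_last]; exact slot_last n y
  have h3 := list_tm n (List.ofFn fun i : Fin (n+1) => slotP K H (n+1) i (z i))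
  refine (congrArg₂ (· * ·) ((congrArg List.prod h1).trans h3) h2).trans ?_
  show tm n _ 1 * tm n 1 y = _
  rw [tm_mul, mul_one, one_mul]

theorem exists_pres (s : TP K H 2) : ∃ (C : ℕ) (u v : Fin C → H),
    s = ∑ c, (u c ⊗ₜ[K] v c : TP K H 2) := by
  refine TensorProduct.induction_on (motive := fun s => ∃ (C : ℕ) (u v : Fin C → H),
    s = ∑ c, (u c ⊗ₜ[K] v c : TP K H 2)) s ⟨0, Fin.elim0, Fin.elim0, ?_⟩ ?_ ?_
  · rfl
  · intro x y
    refine ⟨1, fun _ => x, fun _ => y, ?_⟩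
    rw [Fin.sum_univ_one]
  · rintro a b ⟨C, u, v, rfl⟩ ⟨C', u', v', rfl⟩
    refine ⟨C + C', Fin.append u u', Fin.append v v', ?_⟩
    rw [Fin.sum_univ_add]
    simp only [Fin.append_left, Fin.append_right]

section Gen
variable (αf βf : R → H)

theorem idl_mul (n : ℕ) (z x : TP K H n) (hz : z ∈ Idl K H αf βf n) :
    z * x ∈ Idl K H αf βf n := by
  unfold Idl at hz ⊢
  induction hz using Submodule.span_induction with
  | mem z hz =>
    obtain ⟨r, i, y, hi, rfl⟩ := hz
    exact Submodule.subset_span ⟨r, i, y * x, hi, by rw [mul_assoc]⟩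
  | zero => rw [zero_mul]; exact Submodule.zero_mem _
  | add a b _ _ ha hb => rw [add_mul]; exact Submodule.add_mem _ ha hb
  | smul c a _ ha => rw [smul_mul_assoc]; exact Submodule.smul_mem _ _ ha

theorem mk_mul_congr (n : ℕ) {a b : TP K H n} (x : TP K H n)
    (h : qtMk K H αf βf n a = qtMk K H αf βf n b) :
    qtMk K H αf βf n (a * x) = qtMk K H αf βf n (b * x) := by
  have h' := (Submodule.Quotient.eq _).1 h
  refine (Submodule.Quotient.eq _).2 ?_
  rw [← sub_mul]
  exact idl_mul αf βf n _ _ h'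

theorem idl_one (z : TP K H 1) (hz : z ∈ Idl K H αf βf 1) : z = 0 := by
  unfold Idl at hz
  induction hz using Submodule.span_induction with
  | mem z hz =>
    obtain ⟨r, i, y, hi, rfl⟩ := hz
    omega
  | zero => rfl
  | add a b _ _ ha hb => rw [ha, hb, add_zero]
  | smul c a _ ha => rw [ha, smul_zero]

theorem rel_last (n : ℕ) (r : R) :
    relator K H αf βf (n+2) r n = tm n (slotP K H (n+1) n (βf r)) 1 - tm n 1 (αf r) := by
  unfold relator
  rw [slot_last, slot_lt n n (by omega)]

theorem rel_lt (n i : ℕ) (hi : i < n) (r : R) :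
    relator K H αf βf (n+2) r i = tm n (relator K H αf βf (n+1) r i) 1 := by
  unfold relator
  rw [slot_lt n i (by omega), slot_lt n (i+1) (by omega), map_sub, LinearMap.sub_apply]

theorem idl_tm (n : ℕ) (z : TP K H (n+1)) (x : H) (hz : z ∈ Idl K H αf βf (n+1)) :
    tm n z x ∈ Idl K H αf βf (n+2) := by
  unfold Idl at hz
  induction hz using Submodule.span_induction with
  | mem z hz =>
    obtain ⟨r, i, y, hi, rfl⟩ := hz
    refine Submodule.subset_span ⟨r, i, tm n y x, by omega, ?_⟩
    rw [rel_lt _ _ _ _ (by omega), tm_mul, one_mul]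
  | zero => rw [map_zero]; exact Submodule.zero_mem _
  | add a b _ _ ha hb => rw [map_add]; exact Submodule.add_mem _ ha hb
  | smul c a _ ha => rw [map_smul]; exact Submodule.smul_mem _ _ ha

/-- the projection -/
def B (n : ℕ) : QT K H αf βf (n+1) ⊗[K] H →ₗ[K] QT K H αf βf (n+2) :=
  TensorProduct.lift ((Idl K H αf βf (n+1)).liftQ ((tm n).compr₂ (qtMk K H αf βf (n+2)))
    (by
      intro z hz
      rw [LinearMap.mem_ker]
      ext x
      exact (Submodule.Quotient.mk_eq_zero _).2 (idl_tm αf βf n z x hz)))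

theorem B_mk (n : ℕ) (t : TP K H (n+1)) (x : H) :
    B αf βf n (qtMk K H αf βf (n+1) t ⊗ₜ x) = qtMk K H αf βf (n+2) (tm n t x) := rfl

theorem B_surj (n : ℕ) : Function.Surjective (B (K := K) αf βf n) := by
  intro y
  obtain ⟨y, rfl⟩ := Submodule.mkQ_surjective _ y
  refine tm_ind n (P := fun y => ∃ a, B αf βf n a = qtMk K H αf βf (n+2) y) y
    (fun a x => ⟨_, B_mk αf βf n a x⟩) ?_
  rintro a b ⟨x, hx⟩ ⟨y, hy⟩
  exact ⟨x + y, by rw [map_add, hx, hy, map_add]⟩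

/-- partial projection -/
def T (n : ℕ) : TP K H (n+2) →ₗ[K] QT K H αf βf (n+1) ⊗[K] H :=
  (qtMk K H αf βf (n+1)).rTensor H

theorem T_tm (n : ℕ) (a : TP K H (n+1)) (x : H) :
    T αf βf n (tm n a x) = qtMk K H αf βf (n+1) a ⊗ₜ x := rfl

theorem T_surj (n : ℕ) : Function.Surjective (T (K := K) αf βf n) :=
  LinearMap.rTensor_surjective H (Submodule.mkQ_surjective _)

theorem B_T (n : ℕ) (w : TP K H (n+2)) : B αf βf n (T αf βf n w) = qtMk K H αf βf (n+2) w := by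
  refine tm_ind n (P := fun w => B αf βf n (T αf βf n w) = qtMk K H αf βf (n+2) w) w
    (fun a x => rfl) ?_
  intro a b ha hb
  rw [map_add, map_add, ha, hb, map_add]

/-- relations -/
def mrel {M : Type u} [AddCommGroup M] [Module K M] (b : R → M →ₗ[K] M) :
    Submodule K (M ⊗[K] H) :=
  Submodule.span K {z | ∃ (r : R) (m : M) (x : H), z = (b r m) ⊗ₜ[K] x - m ⊗ₜ[K] (αf r * x)}

theorem B_ker (n : ℕ) (b : R → QT K H αf βf (n+1) →ₗ[K] QT K H αf βf (n+1))
    (hb : ∀ r t, b r (qtMk K H αf βf (n+1) t) =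
      qtMk K H αf βf (n+1) (slotP K H (n+1) n (βf r) * t)) :
    LinearMap.ker (B αf βf n) = mrel αf b := by
  apply le_antisymm
  · intro w hw
    obtain ⟨v, rfl⟩ := T_surj αf βf n w
    rw [LinearMap.mem_ker, B_T] at hw
    have hw' : v ∈ Idl K H αf βf (n+2) := (Submodule.Quotient.mk_eq_zero _).1 hw
    clear hw
    unfold Idl at hw'
    induction hw' using Submodule.span_induction with
    | mem z hz =>
      obtain ⟨r, i, y, hi, rfl⟩ := hz
      refine tm_ind n (P := fun y => T αf βf n (relator K H αf βf (n+2) r i * y) ∈ mrel αf b) y ?_ ?_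
      · intro a x
        by_cases hin : i < n
        · rw [rel_lt _ _ _ _ hin, tm_mul, T_tm]
          have : qtMk K H αf βf (n+1) (relator K H αf βf (n + 1) r i * a) = 0 :=
            (Submodule.Quotient.mk_eq_zero _).2
              (Submodule.subset_span ⟨r, i, a, by omega, rfl⟩)
          rw [this, TensorProduct.zero_tmul]
          exact Submodule.zero_mem _
        · obtain rfl : i = n := by omega
          rw [rel_last, sub_mul, tm_mul, tm_mul, map_sub, T_tm, T_tm, ← hb, one_mul, one_mul]
          exact Submodule.subset_span ⟨_, _, _, rfl⟩
      · intro a b ha hb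
        rw [mul_add, map_add]; exact Submodule.add_mem _ ha hb
    | zero => rw [map_zero]; exact Submodule.zero_mem _
    | add a b _ _ ha hb => rw [map_add]; exact Submodule.add_mem _ ha hb
    | smul c a _ ha => rw [map_smul]; exact Submodule.smul_mem _ _ ha
  · unfold mrel
    rw [Submodule.span_le]
    rintro _ ⟨r, m, x, rfl⟩
    obtain ⟨m, rfl⟩ := Submodule.mkQ_surjective _ m
    have h : B αf βf n (b r (qtMk K H αf βf (n+1) m) ⊗ₜ[K] x -
        qtMk K H αf βf (n+1) m ⊗ₜ[K] (αf r * x)) = 0 := by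
      rw [map_sub, hb, B_mk, B_mk, ← map_sub]
      refine (Submodule.Quotient.mk_eq_zero _).2
        (Submodule.subset_span ⟨r, n, tm n m x, le_rfl, ?_⟩)
      rw [rel_last, sub_mul, tm_mul, tm_mul, one_mul, one_mul]
    exact h

end Gen
theorem equiv_of {X Y Z : Type u} [AddCommGroup X] [Module K X] [AddCommGroup Y] [Module K Y]
    [AddCommGroup Z] [Module K Z] (B : X →ₗ[K] Y) (C : X →ₗ[K] Z)
    (hB : Function.Surjective B) (hC : Function.Surjective C)
    (h : LinearMap.ker B = LinearMap.ker C) :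
    ∃ Φ : Y ≃ₗ[K] Z, ∀ x, Φ (B x) = C x := by
  refine ⟨(B.quotKerEquivOfSurjective hB).symm ≪≫ₗ Submodule.quotEquivOfEq _ _ h ≪≫ₗ
    C.quotKerEquivOfSurjective hC, fun x => ?_⟩
  have : (B.quotKerEquivOfSurjective hB).symm (B x) = Submodule.Quotient.mk x := by
    rw [LinearEquiv.symm_apply_eq]; rfl
  simp only [LinearEquiv.trans_apply, this]
  rfl

theorem lift_of {X Y Z : Type u} [AddCommGroup X] [Module K X] [AddCommGroup Y] [Module K Y]
    [AddCommGroup Z] [Module K Z] (B : X →ₗ[K] Y) (C : X →ₗ[K] Z)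
    (hB : Function.Surjective B) (h : LinearMap.ker B ≤ LinearMap.ker C) :
    ∃ Φ : Y →ₗ[K] Z, ∀ x, Φ (B x) = C x := by
  refine ⟨(LinearMap.ker B).liftQ C h ∘ₗ (B.quotKerEquivOfSurjective hB).symm.toLinearMap,
    fun x => ?_⟩
  have : (B.quotKerEquivOfSurjective hB).symm (B x) = Submodule.Quotient.mk x := by
    rw [LinearEquiv.symm_apply_eq]; rfl
  simp only [LinearMap.comp_apply, LinearEquiv.coe_coe, this]
  rfl

/-- the action on a tensor product -/
def act {M : Type u} [AddCommGroup M] [Module K M] (ρ : H →ₐ[K] Module.End K M) :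
    TP K H 2 →ₐ[K] Module.End K (M ⊗[K] H) :=
  (Module.endTensorEndAlgHom (R := K) (S := K) (A := K) (M := M) (N := H)).comp
    (Algebra.TensorProduct.map ρ (Algebra.lmul K H))

/-- pure tensors in degree two -/
abbrev tt (u v : H) : TP K H 2 := tm 0 u v

theorem tt_mul (u v u' v' : H) : tt (K := K) u v * tt u' v' = tt (u * u') (v * v') :=
  tm_mul 0 u u' v v'

theorem tt_add_right (u v v' : H) : tt (K := K) u (v + v') = tt u v + tt u v' :=
  TensorProduct.tmul_add u v v'

theorem tt_smul_right (c : K) (u v : H) : tt (K := K) u (c • v) = c • tt u v :=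
  (tm 0 u).map_smul c v

theorem tt_sum_right {C : ℕ} (u : H) (v : Fin C → H) :
    tt (K := K) u (∑ c, v c) = ∑ c, tt u (v c) :=
  TensorProduct.tmul_sum u Finset.univ v

theorem slot_two (h : H) : slotP K H 2 1 h = tt 1 h := slot_last 0 h

theorem act_tt {M : Type u} [AddCommGroup M] [Module K M] (ρ : H →ₐ[K] Module.End K M)
    (u v : H) (m : M) (x : H) : act ρ (tt u v) (m ⊗ₜ x) = ρ u m ⊗ₜ (v * x) := rfl

theorem act_map {M : Type u} [AddCommGroup M] [Module K M] (ρ : H →ₐ[K] Module.End K M)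
    (u v : H) (w : M ⊗[K] H) :
    act ρ (tt u v) w = TensorProduct.map (ρ u) (Algebra.lmul K H v) w := rfl

theorem act_mul {M : Type u} [AddCommGroup M] [Module K M] (ρ : H →ₐ[K] Module.End K M)
    (s t : TP K H 2) (w : M ⊗[K] H) : act ρ (s * t) w = act ρ s (act ρ t w) := by
  rw [map_mul]; rfl

theorem rel_two (αf βf : R → H) (r : R) :
    relator K H αf βf 2 r 0 = tt (βf r) 1 - tt 1 (αf r) := rel_last αf βf 0 r

section DD
variable {α : R →ₐ[K] H} {β : R →ₗ[K] H} (D : HopfAlgebroid K H R α β)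

theorem mrel_eq {M : Type u} [AddCommGroup M] [Module K M] (αf βf : R → H)
    (ρ : H →ₐ[K] Module.End K M) :
    modRel K αf βf ρ (Algebra.lmul K H) = mrel αf (fun r => ρ (βf r)) := rfl

theorem act_idl {M : Type u} [AddCommGroup M] [Module K M] (αf βf : R → H)
    (ρ : H →ₐ[K] Module.End K M) (z : TP K H 2) (hz : z ∈ Idl K H αf βf 2) (w : M ⊗[K] H) :
    act ρ z w ∈ mrel αf (fun r => ρ (βf r)) := by
  unfold Idl at hz
  induction hz using Submodule.span_induction with
  | mem z hz =>
    obtain ⟨r, i, y, hi, rfl⟩ := hz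
    obtain rfl : i = 0 := by omega
    rw [act_mul]
    generalize act ρ y w = w'
    rw [rel_two, map_sub, LinearMap.sub_apply]
    induction w' using TensorProduct.induction_on with
    | zero => rw [map_zero, map_zero, sub_zero]; exact Submodule.zero_mem _
    | tmul m x =>
      rw [act_tt, act_tt, one_mul, map_one]
      exact Submodule.subset_span ⟨r, m, x, rfl⟩
    | add a b ha hb =>
      rw [map_add, map_add, add_sub_add_comm]; exact Submodule.add_mem _ ha hb
  | zero => rw [map_zero]; exact Submodule.zero_mem _
  | add a b _ _ ha hb => rw [map_add]; exact Submodule.add_mem _ ha hb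
  | smul c a _ ha => rw [map_smul]; exact Submodule.smul_mem _ _ ha

theorem act_pres {M : Type u} [AddCommGroup M] [Module K M]
    (ρ : H →ₐ[K] Module.End K M) (h : H) (s : TP K H 2) (hs : qmk K H α β 2 s = D.Δ h)
    (w : M ⊗[K] H) (hw : w ∈ mrel (fun a => α a) (fun r => ρ (β r))) :
    act ρ s w ∈ mrel (fun a => α a) (fun r => ρ (β r)) := by
  unfold mrel at hw
  induction hw using Submodule.span_induction with
  | mem z hz =>
    obtain ⟨r, m, x, rfl⟩ := hz
    have h1 : (ρ (β r)) m ⊗ₜ[K] x - m ⊗ₜ[K] (α r * x) =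
        act ρ (relator K H (fun a => α a) (fun a => β a) 2 r 0) (m ⊗ₜ x) := by
      rw [rel_two, map_sub, LinearMap.sub_apply, act_tt, act_tt, one_mul, map_one]; rfl
    rw [h1, ← act_mul]
    exact act_idl (fun a => α a) (fun a => β a) ρ _
      ((Submodule.Quotient.mk_eq_zero _).1 (D.Δ_compat h r s hs)) _
  | zero => rw [map_zero]; exact Submodule.zero_mem _
  | add a b _ _ ha hb => rw [map_add]; exact Submodule.add_mem _ ha hb
  | smul c a _ ha => rw [map_smul]; exact Submodule.smul_mem _ _ ha

theorem mk_surj (n : ℕ) : Function.Surjective (qmk K H α β n) := Submodule.mkQ_surjective _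

theorem pow_succ (n : ℕ) (x u v : H) (h : D.Δ x = qmk K H α β 2 (tt u v)) (s : TP K H (n+1))
    (hs : D.Δpow n u = qmk K H α β (n+1) s) :
    D.Δpow (n+1) x = qmk K H α β (n+2) (tm n s v) :=
  (D.Δpow_succ n x 1 (fun _ => u) (fun _ => v)
    ((congrArg (qmk K H α β 2) (Fin.sum_univ_one _)).trans h.symm) (fun _ => s)
    (fun _ => hs.symm)).trans (congrArg (qmk K H α β (n+2)) (Fin.sum_univ_one _))

theorem pow_one (n : ℕ) : D.Δpow n 1 = qmk K H α β (n+1) 1 := by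
  induction n with
  | zero => exact D.Δpow_zero 1
  | succ n ih =>
    exact pow_succ D n 1 1 1 (by rw [D.Δ_one]; rfl) 1 ih

theorem Δ_β (r : R) : D.Δ (β r) = qmk K H α β 2 (tt 1 (β r)) := by
  have := D.Δ_bimod_right r 1 1 D.Δ_one.symm
  rw [mul_one, mul_one, slot_last] at this
  exact this

theorem pow_β (n : ℕ) (r : R) :
    D.Δpow n (β r) = qmk K H α β (n+1) (slotP K H (n+1) n (β r)) := by
  cases n with
  | zero => exact D.Δpow_zero (β r)
  | succ n =>
    rw [slot_last]
    exact pow_succ D n (β r) 1 (β r) (Δ_β D r) 1 (pow_one D n)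

/-- insertion property -/
def Ins (n : ℕ) (ρ : H →ₐ[K] Module.End K (QT K H (fun a => α a) (fun a => β a) (n+1))) : Prop :=
  ∀ (h : H) (s t : TP K H (n + 1)),
        qmk K H α β (n + 1) s = D.Δpow n h →
        ρ h (qmk K H α β (n + 1) t) = qmk K H α β (n + 1) (s * t)

/-- shorthand -/
abbrev BR (n : ℕ) (α : R →ₐ[K] H) (β : R →ₗ[K] H) :=
  B (K := K) (fun a => α a) (fun a => β a) n

theorem BR_ker (n : ℕ) (ρ : H →ₐ[K] Module.End K (QT K H (fun a => α a) (fun a => β a) (n+1)))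
    (hρ : Ins D n ρ) :
    LinearMap.ker (BR n α β) = mrel (fun a => α a) (fun r => ρ (β r)) :=
  B_ker _ _ n (fun r => ρ (β r)) (fun r t => hρ _ _ _ (pow_β D n r).symm)

theorem act_congr (n : ℕ)
    (ρ : H →ₐ[K] Module.End K (QT K H (fun a => α a) (fun a => β a) (n+1)))
    (hρ : Ins D n ρ) (s s' : TP K H 2) (hs : qmk K H α β 2 s = qmk K H α β 2 s')
    (w : QT K H (fun a => α a) (fun a => β a) (n+1) ⊗[K] H) :
    BR n α β (act ρ s w) = BR n α β (act ρ s' w) := by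
  have h1 : act ρ (s - s') w = act ρ s w - act ρ s' w := by rw [map_sub]; rfl
  rw [← sub_eq_zero, ← map_sub, ← h1]
  have := act_idl (fun a => α a) (fun a => β a) ρ _ ((Submodule.Quotient.eq _).1 hs) w
  rw [← BR_ker D n ρ hρ] at this
  exact this

theorem key (n : ℕ) (ρ : H →ₐ[K] Module.End K (QT K H (fun a => α a) (fun a => β a) (n+1)))
    (hρ : Ins D n ρ) (h : H) (s : TP K H 2) (hs : qmk K H α β 2 s = D.Δ h)
    (S : TP K H (n+2)) (hS : qmk K H α β (n+2) S = D.Δpow (n+1) h) (w : TP K H (n+2)) :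
    BR n α β (act ρ s (T _ _ n w)) = qmk K H α β (n+2) (S * w) := by
  obtain ⟨C, u, v, rfl⟩ := exists_pres s
  choose σ hσ using fun c => mk_surj (α := α) (β := β) (n+1) (D.Δpow n (u c))
  have h1 := D.Δpow_succ n h C u v hs σ hσ
  rw [mk_mul_congr _ _ _ w (hS.trans h1)]
  refine tm_ind n (P := fun w => BR n α β (act ρ (∑ c, tt (u c) (v c)) (T _ _ n w)) =
    qmk K H α β (n+2) ((∑ c, tm n (σ c) (v c)) * w)) w ?_ ?_
  · intro a x
    rw [Finset.sum_mul, map_sum, LinearMap.sum_apply, map_sum, map_sum]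
    refine Finset.sum_congr rfl fun c _ => ?_
    rw [T_tm, act_tt, tm_mul, hρ _ _ _ (hσ c)]
    rfl
  · intro a b ha hb
    rw [mul_add, map_add, map_add, map_add, map_add, ha, hb]

theorem ins_B (n : ℕ) (ρ : H →ₐ[K] Module.End K (QT K H (fun a => α a) (fun a => β a) (n+1)))
    (hρ : Ins D n ρ)
    (ρ' : H →ₐ[K] Module.End K (QT K H (fun a => α a) (fun a => β a) (n+2)))
    (hρ' : Ins D (n+1) ρ') (h : H) (s : TP K H 2) (hs : qmk K H α β 2 s = D.Δ h)
    (w : QT K H (fun a => α a) (fun a => β a) (n+1) ⊗[K] H) :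
    ρ' h (BR n α β w) = BR n α β (act ρ s w) := by
  obtain ⟨w, rfl⟩ := T_surj _ _ n w
  obtain ⟨S, hS⟩ := mk_surj (α := α) (β := β) (n+2) (D.Δpow (n+1) h)
  rw [key D n ρ hρ h s hs S hS, B_T]
  exact hρ' h S w hS

set_option maxHeartbeats 1000000 in
theorem ins_exists (n : ℕ) :
    ∃ ρ : H →ₐ[K] Module.End K (QT K H (fun a => α a) (fun a => β a) (n+1)), Ins D n ρ := by
  induction n with
  | zero =>
    have h0 : ∀ z : TP K H 1, z ∈ Idl K H (fun a => α a) (fun a => β a) 1 → z = 0 :=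
      idl_one _ _
    have : ∀ h : H, ∃ f : Module.End K (QT K H (fun a => α a) (fun a => β a) 1),
        ∀ t, f (qmk K H α β 1 t) = qmk K H α β 1 ((show TP K H 1 from h) * t) := by
      intro h
      exact lift_of (qmk K H α β 1)
        (qmk K H α β 1 ∘ₗ LinearMap.mulLeft K (show TP K H 1 from h)) (mk_surj 1) (by
          intro z hz
          have hz' := h0 z ((Submodule.Quotient.mk_eq_zero _).1 hz)
          rw [hz']; exact Submodule.zero_mem _)
    choose f hf using this
    have ext : ∀ g g' : Module.End K (QT K H (fun a => α a) (fun a => β a) 1),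
        (∀ t, g (qmk K H α β 1 t) = g' (qmk K H α β 1 t)) → g = g' := by
      intro g g' hg
      refine LinearMap.ext fun y => ?_
      obtain ⟨t, rfl⟩ := mk_surj (α := α) (β := β) 1 y
      exact hg t
    refine ⟨AlgHom.ofLinearMap { toFun := f, map_add' := ?_, map_smul' := ?_ } ?_ ?_, ?_⟩
    · intro x y
      refine ext _ _ fun t => ?_
      rw [LinearMap.add_apply, hf, hf, hf, ← map_add]
      exact congrArg _ (add_mul x y t)
    · intro c x
      refine ext _ _ fun t => ?_
      rw [RingHom.id_apply, LinearMap.smul_apply, hf, hf, ← map_smul]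
      exact congrArg _ (smul_mul_assoc c x t)
    · refine ext _ _ fun t => ?_
      exact (hf 1 t).trans (congrArg _ (one_mul t))
    · intro x y
      refine ext _ _ fun t => ?_
      refine (hf _ t).trans ?_
      refine Eq.trans ?_ (congrArg (f x) (hf y t)).symm
      refine Eq.trans ?_ (hf x _).symm
      exact congrArg _ (mul_assoc x y t)
    · intro h s t hs
      refine (hf h t).trans ?_
      rw [D.Δpow_zero] at hs
      exact (mk_mul_congr _ _ 1 t hs).symm
  | succ n ih =>
    obtain ⟨ρ, hρ⟩ := ih
    have hk := BR_ker D n ρ hρ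
    have hsurj : Function.Surjective (BR n α β) := B_surj _ _ n
    choose l hl using fun h => mk_surj (α := α) (β := β) 2 (D.Δ h)
    have : ∀ h : H, ∃ f : Module.End K (QT K H (fun a => α a) (fun a => β a) (n+2)),
        ∀ w, f (BR n α β w) = BR n α β (act ρ (l h) w) := by
      intro h
      exact lift_of (BR n α β) (BR n α β ∘ₗ act ρ (l h)) hsurj (by
          intro z hz
          rw [hk] at hz
          have := act_pres D ρ h (l h) (hl h) z hz
          rw [← hk] at this
          exact this)
    choose f hf using this
    have hf' : ∀ h s, qmk K H α β 2 s = D.Δ h → ∀ w, f h (BR n α β w) = BR n α β (act ρ s w) := by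
      intro h s hs w
      rw [hf]; exact act_congr D n ρ hρ _ _ ((hl h).trans hs.symm) w
    have ext : ∀ g g' : Module.End K (QT K H (fun a => α a) (fun a => β a) (n+2)),
        (∀ t, g (BR n α β t) = g' (BR n α β t)) → g = g' := by
      intro g g' hg
      refine LinearMap.ext fun y => ?_
      obtain ⟨t, rfl⟩ := hsurj y
      exact hg t
    refine ⟨AlgHom.ofLinearMap { toFun := f, map_add' := ?_, map_smul' := ?_ } ?_ ?_, ?_⟩
    · intro x y
      refine ext _ _ fun t => ?_
      rw [LinearMap.add_apply, hf' (x+y) (l x + l y) (by rw [map_add, hl, hl, map_add]), hf, hf,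
        map_add, LinearMap.add_apply, map_add]
    · intro c x
      refine ext _ _ fun t => ?_
      rw [RingHom.id_apply, LinearMap.smul_apply,
        hf' (c • x) (c • l x) (by rw [map_smul, hl, map_smul]), hf,
        map_smul, LinearMap.smul_apply, map_smul]
    · refine ext _ _ fun t => ?_
      refine (hf' 1 1 D.Δ_one.symm t).trans ?_
      rw [map_one]; rfl
    · intro x y
      refine ext _ _ fun t => ?_
      refine (hf' (x*y) (l x * l y) (D.Δ_mul x y _ _ (hl x) (hl y)).symm t).trans ?_
      rw [act_mul]
      refine Eq.trans ?_ (congrArg (f x) (hf y t)).symm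
      exact (hf x _).symm
    · intro h s t hs
      have := key D n ρ hρ h (l h) (hl h) s hs t
      have e1 := hf h (T _ _ n t)
      have e2 := B_T (K := K) (fun a => α a) (fun a => β a) n t
      exact (congrArg (f h) e2.symm).trans (e1.trans this)

/-- evaluation of the last slot at an element of the base -/
def Psi (r : R) : TP K H 3 →ₗ[K] QT K H (fun a => α a) (fun a => β a) 2 :=
  TensorProduct.lift (LinearMap.mk₂ K
    (fun (w : TP K H 2) (z : H) => qmk K H α β 2 (tt 1 (β (D.ε (z * α r))) * w))
    (fun a b z => by rw [mul_add, map_add])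
    (fun c a z => by rw [mul_smul_comm, map_smul])
    (fun a z z' => by rw [add_mul, map_add, map_add, tt_add_right, add_mul, map_add])
    (fun c a z => by rw [smul_mul_assoc, map_smul, map_smul, tt_smul_right, smul_mul_assoc, map_smul]))

theorem Psi_tm (r : R) (w : TP K H 2) (z : H) :
    Psi D r (tm 1 w z) = qmk K H α β 2 (tt 1 (β (D.ε (z * α r))) * w) := rfl

theorem Psi_idl (r : R) (z : TP K H 3) (hz : z ∈ Idl K H (fun a => α a) (fun a => β a) 3) :
    Psi D r z = 0 := by
  unfold Idl at hz
  induction hz using Submodule.span_induction with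
  | mem z hz =>
    obtain ⟨a, i, y, hi, rfl⟩ := hz
    refine tm_ind 1 (P := fun y => Psi D r
      (relator K H (fun a => α a) (fun a => β a) 3 a i * y) = 0) y ?_ ?_
    · intro w x
      obtain rfl | rfl : i = 0 ∨ i = 1 := by omega
      · rw [rel_lt _ _ 1 0 (by omega), tm_mul, Psi_tm, ← mul_assoc]
        have : tt 1 (β (D.ε (1 * x * α r))) * relator K H (fun a => α a) (fun a => β a) 2 a 0
            = relator K H (fun a => α a) (fun a => β a) 2 a 0 *
              tt 1 (β (D.ε (1 * x * α r))) := by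
          rw [rel_two, mul_sub, sub_mul, tt_mul, tt_mul, tt_mul, tt_mul, D.αβ_comm]
          simp only [mul_one, one_mul]
        refine (Submodule.Quotient.mk_eq_zero _).2 (Submodule.subset_span ?_)
        refine ⟨a, 0, tt 1 (β (D.ε (1 * x * α r))) * w, le_rfl, ?_⟩
        erw [this]
        rw [mul_assoc]
      · rw [rel_last _ _ 1, sub_mul, tm_mul, tm_mul, map_sub, Psi_tm, Psi_tm, slot_two,
          ← mul_assoc, tt_mul, one_mul, one_mul, one_mul, mul_assoc, D.ε_bimod_left, D.β_mul,
          sub_self]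
    · intro a b ha hb
      rw [mul_add, map_add, ha, hb, add_zero]
  | zero => rw [map_zero]
  | add a b _ _ ha hb => rw [map_add, ha, hb, add_zero]
  | smul c a _ ha => rw [map_smul, ha, smul_zero]

/-- reassociation -/
def as3 (a : H) : TP K H 2 →ₗ[K] TP K H 3 :=
  (TensorProduct.assoc K H H H).symm.toLinearMap ∘ₗ TensorProduct.mk K H (H ⊗[K] H) a

theorem as3_tt (a u v : H) : as3 (K := K) a (tt u v) = tm 1 (tt a u) v := rfl

theorem ε_mul_β (x y : H) : D.ε (x * β (D.ε y)) = D.ε (x * y) := by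
  have h := D.ker_ε_ideal x (β (D.ε y) - y) (by
    have := D.ε_bimod_right (D.ε y) 1
    rw [mul_one, D.ε_one, one_mul] at this
    rw [map_sub, this, sub_self])
  rwa [mul_sub, map_sub, sub_eq_zero] at h

theorem counit_β (x b : H) (t : TP K H 2) (ht : qmk K H α β 2 t = D.Δ x)
    (C : ℕ) (u v : Fin C → H) (htuv : t = ∑ c, tt (u c) (v c)) :
    ∑ c, β (D.ε (v c * b)) * u c = x * β (D.ε b) := by
  have h1 := D.counit_right (x * β (D.ε b)) C u (fun c => v c * β (D.ε b)) (by
    rw [D.Δ_mul x (β (D.ε b)) t (tt 1 (β (D.ε b))) ht (Δ_β D _).symm, htuv, Finset.sum_mul]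
    refine congrArg _ (Finset.sum_congr rfl fun c _ => ?_)
    refine Eq.trans ?_ (tm_mul 0 _ _ _ _).symm
    exact congrArg (fun z => tt z _) (mul_one (u c)).symm)
  rw [← h1]
  refine Finset.sum_congr rfl fun c _ => ?_
  rw [ε_mul_β]

variable {C : ℕ} (p q : Fin C → H)

/-- the twistor -/
def FF : TP K H 2 := ∑ c, tt (p c) (q c)

theorem twist_beta (htw : IsTwistor D p q) (r : R) (s' : TP K H 2)
    (hs' : qmk K H α β 2 s' = D.Δ (betaF D p q r)) :
    qmk K H α β 2 (s' * FF p q) = qmk K H α β 2 (FF p q * tt 1 (betaF D p q r)) := by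
  obtain ⟨⟨s, t, hs, ht, h1⟩, -, -⟩ := htw
  have h2 : qmk K H α β 3 ((∑ c, tm 1 (s c) (q c)) * tm 1 (FF p q) 1) =
      qmk K H α β 3 ((∑ c, as3 (p c) (t c)) * as3 1 (FF p q)) := by
    have e1 : tm 1 (FF p q) (1 : H) = (∑ c, tm (K := K) 1 (tt (p c) (q c)) (1 : H)) := by
      rw [FF, map_sum, LinearMap.sum_apply]
    have e2 : as3 (1 : H) (FF p q) = ∑ c, as3 (K := K) 1 (tt (p c) (q c)) := by
      rw [FF, map_sum]
    rw [e1, e2]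
    exact h1
  have h3 := Psi_idl D r _ ((Submodule.Quotient.eq _).1 h2)
  rw [map_sub, sub_eq_zero] at h3
  have h4 : Psi D r ((∑ c, tm 1 (s c) (q c)) * tm 1 (FF p q) 1) =
      qmk K H α β 2 (s' * FF p q) := by
    have : qmk K H α β 2 s' = qmk K H α β 2 (∑ c, tt 1 (β (D.hAct (q c) r)) * s c) := by
      rw [hs', betaF, map_sum, map_sum]
      refine Finset.sum_congr rfl fun c _ => ?_
      have := D.Δ_bimod_right (D.hAct (q c) r) (p c) (s c) (hs c)
      rw [this, slot_two]
    rw [mk_mul_congr _ _ 2 _ this, Finset.sum_mul, Finset.sum_mul, map_sum, map_sum]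
    refine Finset.sum_congr rfl fun c _ => ?_
    rw [tm_mul, Psi_tm, mul_one, mul_assoc]; rfl
  have h5 : Psi D r ((∑ c, as3 (p c) (t c)) * as3 1 (FF p q)) =
      qmk K H α β 2 (FF p q * tt 1 (betaF D p q r)) := by
    have e1 : FF (K := K) p q * tt 1 (betaF D p q r) =
        ∑ c, ∑ c', tt (p c) (q c * (β (D.ε (q c' * α r)) * p c')) := by
      rw [FF, Finset.sum_mul]
      refine Finset.sum_congr rfl fun c _ => ?_
      rw [tt_mul, betaF, Finset.mul_sum, tt_sum_right]
      refine Finset.sum_congr rfl fun c' _ => ?_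
      exact congrArg (fun z => tt z _) (mul_one (p c))
    rw [e1, Finset.sum_mul, map_sum, map_sum]
    refine Finset.sum_congr rfl fun c _ => ?_
    rw [FF, map_sum, Finset.mul_sum, map_sum, map_sum]
    refine Finset.sum_congr rfl fun c' _ => ?_
    obtain ⟨N, u, v, huv⟩ := exists_pres (t c)
    have h6 := counit_β D (q c) (q c' * α r) (t c) (ht c) N u v huv
    have huv' : t c = ∑ d, tt (u d) (v d) := huv
    rw [← mul_assoc, ← h6, huv', as3_tt, map_sum, Finset.sum_mul, Finset.sum_mul, map_sum, tt_sum_right,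
      map_sum]
    refine Finset.sum_congr rfl fun d _ => ?_
    rw [as3_tt, tm_mul, Psi_tm]
    refine congrArg _ ?_
    rw [tt_mul, tt_mul, ← mul_assoc, mul_assoc (v d), ← mul_assoc]
    refine congrArg (fun z => tt z _) ?_
    exact (mul_one (1 * p c)).trans (one_mul (p c))
  rw [← h4, h3, h5]

/-- the elements `E_n` -/
def ee : ∀ n : ℕ, TP K H n
  | 0 => 1
  | 1 => 1
  | (n + 2) => (∑ c, tm n (Function.surjInv (mk_surj (α := α) (β := β) (n+1))
      (D.Δpow n (p c))) (q c)) * tm n (ee (n+1)) 1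

theorem ee_one : ee D p q 1 = 1 := by rw [ee]

theorem ee_succ (n : ℕ) (σ : Fin C → TP K H (n+1))
    (hσ : ∀ c, qmk K H α β (n+1) (σ c) = D.Δpow n (p c)) :
    qmk K H α β (n+2) (ee D p q (n+2)) =
      qmk K H α β (n+2) ((∑ c, tm n (σ c) (q c)) * tm n (ee D p q (n+1)) 1) := by
  rw [ee]
  refine mk_mul_congr _ _ _ _ ?_
  rw [map_sum, map_sum]
  refine Finset.sum_congr rfl fun c _ => ?_
  have : qmk K H α β (n+1) (Function.surjInv (mk_surj (α := α) (β := β) (n+1))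
      (D.Δpow n (p c))) = qmk K H α β (n+1) (σ c) := by
    rw [hσ]; exact Function.surjInv_eq _ _
  have h2 := congrArg (fun z => BR n α β (z ⊗ₜ q c)) this
  exact h2

theorem ee_B (n : ℕ) (ρ : H →ₐ[K] Module.End K (QT K H (fun a => α a) (fun a => β a) (n+1)))
    (hρ : Ins D n ρ) (a : TP K H (n+1)) (x : H) :
    qmk K H α β (n+2) (ee D p q (n+2) * tm n a x) =
      BR n α β (act ρ (FF p q) (qmk K H α β (n+1) (ee D p q (n+1) * a) ⊗ₜ x)) := by
  choose σ hσ using fun c => mk_surj (α := α) (β := β) (n+1) (D.Δpow n (p c))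
  rw [mk_mul_congr _ _ _ _ (ee_succ D p q n σ hσ), mul_assoc, tm_mul, one_mul, Finset.sum_mul,
    FF, map_sum, map_sum, LinearMap.sum_apply, map_sum]
  refine Finset.sum_congr rfl fun c _ => ?_
  rw [act_tt, hρ _ _ _ (hσ c), tm_mul]
  rfl

theorem ee_beta (htw : IsTwistor D p q) (n : ℕ)
    (ρ : H →ₐ[K] Module.End K (QT K H (fun a => α a) (fun a => β a) (n+1)))
    (hρ : Ins D n ρ) (r : R) :
    ρ (betaF D p q r) (qmk K H α β (n+1) (ee D p q (n+1))) =
      qmk K H α β (n+1) (ee D p q (n+1) * slotP K H (n+1) n (betaF D p q r)) := by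
  cases n with
  | zero =>
    refine (hρ _ (slotP K H 1 0 (betaF D p q r)) _ (D.Δpow_zero _).symm).trans ?_
    refine congrArg _ ?_
    have h1 : ee D p q (0+1) = 1 := ee_one D p q
    rw [h1]
    exact (mul_one (betaF D p q r)).trans (one_mul (betaF D p q r)).symm
  | succ n =>
    obtain ⟨ρ', hρ'⟩ := ins_exists D n
    obtain ⟨s, hs⟩ := mk_surj (α := α) (β := β) 2 (D.Δ (betaF D p q r))
    rw [slot_last, ee_B D p q n ρ' hρ', mul_one]
    have h1 := ee_B D p q n ρ' hρ' 1 1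
    rw [tm_one, mul_one, mul_one] at h1
    rw [h1, ins_B D n ρ' hρ' ρ hρ _ s hs, ← act_mul,
      act_congr D n ρ' hρ' _ _ (twist_beta D p q htw r s hs), act_mul, act_tt, map_one, mul_one]
    rfl

/-- twisted quotient map -/
abbrev mF (n : ℕ) : TP K H n →ₗ[K] QT K H (alphaF D p q) (betaF D p q) n :=
  qtMk K H (alphaF D p q) (betaF D p q) n

theorem mrel_iff {M N : Type u} [AddCommGroup M] [Module K M] [AddCommGroup N] [Module K N]
    (αf : R → H) (Φ : M ≃ₗ[K] N) (b : R → M →ₗ[K] M) (b' : R → N →ₗ[K] N)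
    (hb : ∀ r m, Φ (b r m) = b' r (Φ m)) (w : M ⊗[K] H) :
    w ∈ mrel αf b ↔ TensorProduct.congr Φ (LinearEquiv.refl K H) w ∈ mrel αf b' := by
  have : (mrel αf b).map (TensorProduct.congr Φ (LinearEquiv.refl K H)).toLinearMap
      = mrel αf b' := by
    unfold mrel
    rw [Submodule.map_span]
    congr 1
    ext z
    constructor
    · rintro ⟨_, ⟨r, m, x, rfl⟩, rfl⟩
      refine ⟨r, Φ m, x, ?_⟩
      rw [map_sub, ← hb]; rfl
    · rintro ⟨r, m, x, rfl⟩
      obtain ⟨m, rfl⟩ := Φ.surjective m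
      refine ⟨_, ⟨r, m, x, rfl⟩, ?_⟩
      rw [map_sub, ← hb]; rfl
  rw [← this]
  constructor
  · intro h; exact ⟨w, h, rfl⟩
  · rintro ⟨w', h, hw⟩
    rwa [← (TensorProduct.congr Φ (LinearEquiv.refl K H)).injective hw]

theorem fs_exists (htw : IsTwistor D p q) (n : ℕ) :
    ∃ Φ : QT K H (alphaF D p q) (betaF D p q) (n+1) ≃ₗ[K]
        QT K H (fun a => α a) (fun a => β a) (n+1),
      ∀ t, Φ (mF D p q (n+1) t) = qmk K H α β (n+1) (ee D p q (n+1) * t) := by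
  induction n with
  | zero =>
    obtain ⟨Φ, h⟩ := equiv_of (mF D p q 1) (qmk K H α β 1) (Submodule.mkQ_surjective _)
      (mk_surj 1) (by
        rw [Submodule.ker_mkQ, Submodule.ker_mkQ]
        ext z
        constructor
        · intro h; rw [idl_one _ _ z h]; exact Submodule.zero_mem _
        · intro h; rw [idl_one _ _ z h]; exact Submodule.zero_mem _)
    refine ⟨Φ, fun t => ?_⟩
    refine (h t).trans ?_
    rw [ee_one]
    exact congrArg _ (one_mul t).symm
  | succ n ih =>
    obtain ⟨Φ, hΦ⟩ := ih
    obtain ⟨ρ, hρ⟩ := ins_exists D n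
    let b : R → QT K H (alphaF D p q) (betaF D p q) (n+1) →ₗ[K]
        QT K H (alphaF D p q) (betaF D p q) (n+1) :=
      fun r => Φ.symm.toLinearMap ∘ₗ ρ (betaF D p q r) ∘ₗ Φ.toLinearMap
    have hbΦ : ∀ r m, Φ (b r m) = ρ (betaF D p q r) (Φ m) := fun r m =>
      Φ.apply_symm_apply _
    have hb : ∀ r t, b r (mF D p q (n+1) t) =
        mF D p q (n+1) (slotP K H (n+1) n (betaF D p q r) * t) := by
      intro r t
      apply Φ.injective
      obtain ⟨S, hS⟩ := mk_surj (α := α) (β := β) (n+1) (D.Δpow n (betaF D p q r))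
      have h1 := ee_beta D p q htw n ρ hρ r
      rw [hρ _ _ _ hS] at h1
      rw [hbΦ, hΦ, hΦ, hρ _ _ _ hS, ← mul_assoc, ← mul_assoc]
      exact mk_mul_congr _ _ _ t h1
    have hkF := B_ker (alphaF D p q) (betaF D p q) n b hb
    have hkR := BR_ker D n ρ hρ
    obtain ⟨G, hG, hGb⟩ := htw.2.2 _ H ρ (Algebra.lmul K H)
    let cg := TensorProduct.congr Φ (LinearEquiv.refl K H)
    have hG' : ∀ w, G (Submodule.Quotient.mk w) = Submodule.Quotient.mk (act ρ (FF p q) w) := by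
      intro w
      rw [hG, FF, map_sum, LinearMap.sum_apply]
      rfl
    have hker : LinearMap.ker (B (alphaF D p q) (betaF D p q) n) =
        LinearMap.ker (BR n α β ∘ₗ act ρ (FF p q) ∘ₗ cg.toLinearMap) := by
      ext w
      rw [hkF, mrel_iff (alphaF D p q) Φ b (fun r => ρ (betaF D p q r)) hbΦ]
      have e1 : w ∈ LinearMap.ker (BR n α β ∘ₗ act ρ (FF p q) ∘ₗ cg.toLinearMap) ↔
          act ρ (FF p q) (cg w) ∈ LinearMap.ker (BR n α β) := Iff.rfl
      rw [e1, hkR, ← mrel_eq, ← mrel_eq]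
      rw [← Submodule.Quotient.mk_eq_zero, ← Submodule.Quotient.mk_eq_zero (modRel K (fun a => α a) _ _ _), ← hG']
      constructor
      · intro h; exact (congrArg G h).trans (map_zero G)
      · intro h; exact hGb.1 (h.trans (map_zero G).symm)
    have hsurj : Function.Surjective (BR n α β ∘ₗ act ρ (FF p q) ∘ₗ cg.toLinearMap) := by
      intro y
      obtain ⟨w, rfl⟩ := B_surj _ _ n y
      obtain ⟨v, hv⟩ := hGb.2 (Submodule.Quotient.mk w)
      obtain ⟨v, rfl⟩ := Submodule.mkQ_surjective _ v
      have hv' := (hG' v).symm.trans hv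
      have h3 := (Submodule.Quotient.eq _).1 hv'
      rw [mrel_eq] at h3
      refine ⟨cg.symm v, ?_⟩
      have h4 : act ρ (FF p q) v - w ∈ LinearMap.ker (BR n α β) := by rw [hkR]; exact h3
      have h5 := LinearMap.mem_ker.1 h4
      rw [map_sub, sub_eq_zero] at h5
      rw [← h5]
      exact congrArg (fun z => BR n α β (act ρ (FF p q) z)) (cg.apply_symm_apply v)
    obtain ⟨Ψ, hΨ⟩ := equiv_of _ _ (B_surj (alphaF D p q) (betaF D p q) n) hsurj hker
    refine ⟨Ψ, fun t => ?_⟩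
    refine tm_ind n (P := fun t => Ψ (mF D p q (n+2) t) =
      qmk K H α β (n+2) (ee D p q (n+2) * t)) t ?_ ?_
    · intro a x
      rw [ee_B D p q n ρ hρ, ← hΦ]
      exact hΨ (mF D p q (n+1) a ⊗ₜ x)
    · intro a b ha hb
      rw [mul_add, map_add, map_add, ha, hb, map_add]

theorem ee_two (htw : IsTwistor D p q) : qmk K H α β 2 (ee D p q 2) = qmk K H α β 2 (FF p q) := by
  refine (ee_succ D p q 0 p (fun c => (D.Δpow_zero _).symm)).trans (congrArg _ ?_)
  have h1 : ee D p q (0+1) = 1 := ee_one D p q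
  rw [h1, tm_one]
  exact mul_one (FF p q)

theorem echain (htw : IsTwistor D p q) : IsEChain D p q (ee D p q) := by
  refine ⟨by rw [ee_one], ee_two D p q htw, fun n CP ZP h => ?_⟩
  refine (ee_succ D p q n _ h).trans (congrArg _ ?_)
  refine congrArg (· * tm n (ee D p q (n+1)) 1) ?_
  refine Finset.sum_congr rfl fun c _ => ?_
  rw [map_sum, LinearMap.sum_apply]
  exact Finset.sum_congr rfl fun d _ => (chain_snoc n _ _).symm

/-- the transported action -/
def insF {n : ℕ} (ρ : H →ₐ[K] Module.End K (QT K H (fun a => α a) (fun a => β a) (n+1)))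
    (Φ : QT K H (alphaF D p q) (betaF D p q) (n+1) ≃ₗ[K]
        QT K H (fun a => α a) (fun a => β a) (n+1)) :
    H →ₗ[K] QT K H (alphaF D p q) (betaF D p q) (n+1) →ₗ[K]
      QT K H (alphaF D p q) (betaF D p q) (n+1) :=
  Φ.symm.conj.toLinearMap ∘ₗ ρ.toLinearMap

section
variable {n : ℕ} (ρ : H →ₐ[K] Module.End K (QT K H (fun a => α a) (fun a => β a) (n+1)))
    (Φ : QT K H (alphaF D p q) (betaF D p q) (n+1) ≃ₗ[K]
        QT K H (fun a => α a) (fun a => β a) (n+1))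

theorem insF_Φ (h : H) (u : QT K H (alphaF D p q) (betaF D p q) (n+1)) :
    Φ (insF D p q ρ Φ h u) = ρ h (Φ u) := Φ.apply_symm_apply _

/-- the twisted coproduct -/
def Dp : H →ₗ[K] QT K H (alphaF D p q) (betaF D p q) (n+1) :=
  (insF D p q ρ Φ).flip (mF D p q (n+1) 1)

theorem Dp_Φ (hΦ : ∀ t, Φ (mF D p q (n+1) t) = qmk K H α β (n+1) (ee D p q (n+1) * t)) (h : H) :
    Φ (Dp D p q ρ Φ h) = ρ h (qmk K H α β (n+1) (ee D p q (n+1))) := by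
  refine (insF_Φ D p q ρ Φ h _).trans ?_
  rw [hΦ, mul_one]

theorem insF_clause (hρ : Ins D n ρ)
    (hΦ : ∀ t, Φ (mF D p q (n+1) t) = qmk K H α β (n+1) (ee D p q (n+1) * t)) (h : H)
    (s t : TP K H (n+1)) (hs : mF D p q (n+1) s = Dp D p q ρ Φ h) :
    insF D p q ρ Φ h (mF D p q (n+1) t) = mF D p q (n+1) (s * t) := by
  apply Φ.injective
  obtain ⟨S, hS⟩ := mk_surj (α := α) (β := β) (n+1) (D.Δpow n h)
  have h1 := congrArg Φ hs
  rw [hΦ, Dp_Φ D p q ρ Φ hΦ, hρ _ _ _ hS] at h1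
  rw [insF_Φ, hΦ, hΦ, hρ _ _ _ hS, ← mul_assoc, ← mul_assoc]
  exact (mk_mul_congr _ _ _ t h1).symm

end

theorem DF_clause (htw : IsTwistor D p q)
    (ρ : H →ₐ[K] Module.End K (QT K H (fun a => α a) (fun a => β a) 2))
    (Φ : QT K H (alphaF D p q) (betaF D p q) 2 ≃ₗ[K]
        QT K H (fun a => α a) (fun a => β a) 2)
    (hρ : Ins D 1 ρ)
    (hΦ : ∀ t, Φ (mF D p q 2 t) = qmk K H α β 2 (ee D p q 2 * t))
    (x : H) (s : TP K H 2) (hs : qmk K H α β 2 s = D.Δ x) :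
    Φ (Dp (n := 1) D p q ρ Φ x) = qmk K H α β 2 (s * FF p q) := by
  refine (Dp_Φ (n := 1) D p q ρ Φ hΦ x).trans ?_
  refine (congrArg (ρ x) (ee_two D p q htw)).trans ?_
  exact hρ x s (FF p q) (by rw [D.Δpow_one]; exact hs)

theorem iter_succ (htw : IsTwistor D p q) (n : ℕ)
    (ρ1 : H →ₐ[K] Module.End K (QT K H (fun a => α a) (fun a => β a) 2))
    (Φ1 : QT K H (alphaF D p q) (betaF D p q) 2 ≃ₗ[K]
        QT K H (fun a => α a) (fun a => β a) 2)
    (hρ1 : Ins D 1 ρ1)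
    (hΦ1 : ∀ t, Φ1 (mF D p q 2 t) = qmk K H α β 2 (ee D p q 2 * t))
    (ρ : H →ₐ[K] Module.End K (QT K H (fun a => α a) (fun a => β a) (n+1)))
    (Φ : QT K H (alphaF D p q) (betaF D p q) (n+1) ≃ₗ[K]
        QT K H (fun a => α a) (fun a => β a) (n+1))
    (hρ : Ins D n ρ)
    (hΦ : ∀ t, Φ (mF D p q (n+1) t) = qmk K H α β (n+1) (ee D p q (n+1) * t))
    (ρ' : H →ₐ[K] Module.End K (QT K H (fun a => α a) (fun a => β a) (n+2)))
    (Φ' : QT K H (alphaF D p q) (betaF D p q) (n+2) ≃ₗ[K]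
        QT K H (fun a => α a) (fun a => β a) (n+2))
    (hρ' : Ins D (n+1) ρ')
    (hΦ' : ∀ t, Φ' (mF D p q (n+2) t) = qmk K H α β (n+2) (ee D p q (n+2) * t))
    (x : H) (N : ℕ) (uu vv : Fin N → H)
    (hx : mF D p q 2 (∑ c, tt (uu c) (vv c)) = Dp (n := 1) D p q ρ1 Φ1 x)
    (s : Fin N → TP K H (n+1)) (hs : ∀ c, mF D p q (n+1) (s c) = Dp D p q ρ Φ (uu c)) :
    Dp (n := n+1) D p q ρ' Φ' x = mF D p q (n+2) (∑ c, tm n (s c) (vv c)) := by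
  apply Φ'.injective
  obtain ⟨S, hS⟩ := mk_surj (α := α) (β := β) 2 (D.Δ x)
  have h1 := congrArg Φ1 hx
  rw [hΦ1, DF_clause D p q htw ρ1 Φ1 hρ1 hΦ1 x S hS,
    mk_mul_congr _ _ _ _ (ee_two D p q htw)] at h1
  have h2 := ee_B D p q n ρ hρ 1 1
  rw [tm_one, mul_one, mul_one] at h2
  refine (Dp_Φ (n := n+1) D p q ρ' Φ' hΦ' x).trans ?_
  refine (congrArg (ρ' x) h2).trans ?_
  rw [ins_B D n ρ hρ ρ' hρ' x S hS, ← act_mul, ← act_congr D n ρ hρ _ _ h1, hΦ', Finset.mul_sum,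
    Finset.mul_sum, map_sum, LinearMap.sum_apply, map_sum, map_sum]
  refine Finset.sum_congr rfl fun c _ => ?_
  rw [ee_B D p q n ρ hρ, act_mul, act_tt, mul_one, ← hΦ, hs c, Dp_Φ D p q ρ Φ hΦ]

/-- F sharp in all degrees -/
def FsAll (Φ : ∀ n : ℕ, QT K H (alphaF D p q) (betaF D p q) (n+1) ≃ₗ[K]
        QT K H (fun a => α a) (fun a => β a) (n+1)) :
    ∀ n : ℕ, PH K H (alphaF D p q) (betaF D p q) n →ₗ[K]
          PH K H (fun a => α a) (fun a => β a) n
  | 0 => (LinearMap.id : R →ₗ[K] R)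
  | (n+1) => (Φ n).toLinearMap

theorem dp_zero (ρ : H →ₐ[K] Module.End K (QT K H (fun a => α a) (fun a => β a) 1))
    (Φ : QT K H (alphaF D p q) (betaF D p q) 1 ≃ₗ[K]
        QT K H (fun a => α a) (fun a => β a) 1)
    (hρ : Ins D 0 ρ)
    (hΦ : ∀ t, Φ (mF D p q 1 t) = qmk K H α β 1 (ee D p q 1 * t))
    (x : H) : Φ (Dp (n := 0) D p q ρ Φ x) = Φ (mF D p q 1 (slotP K H 1 0 x)) := by
  refine (Dp_Φ (n := 0) D p q ρ Φ hΦ x).trans ?_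
  refine (hρ x (slotP K H 1 0 x) _ (D.Δpow_zero _).symm).trans ?_
  refine Eq.trans (congrArg _ ?_) (hΦ _).symm
  have h1 : ee D p q 1 = 1 := ee_one D p q
  rw [h1]
  exact (mul_one x).trans (one_mul x).symm
end DD
end
end FSI
/-! ### STATEMENT 14 -/

/-- **`F♯` intertwines the insertion actions.**
Let `F = Σ_c (p c) ⊗_R (q c)` be a twistor of the Hopf algebroid `H` and `H_F` the
twisted Hopf algebroid over `R_F`, with coproduct `Δ_F(x) = (F♯)⁻¹(Δ(x) · F)`.  Then for
every `k ≥ 1` (below: `k + 1`), every `h ∈ H` and every `u ∈ H^{⊗_{R_F} k}`,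
`F♯((Δ_F^{k−1}h) · u) = (Δ^{k−1}h) · (F♯ u)` in `H^{⊗_R k}`, where on the left the
insertion action is that of `H_F` and on the right that of `H`. -/
theorem FSharp_intertwines_insertion
    (K : Type u) [Field K] [CharZero K]
    (H : Type u) [Ring H] [Algebra K H]
    (R : Type u) [Ring R] [Algebra K R]
    (α : R →ₐ[K] H) (β : R →ₗ[K] H)
    (D : HopfAlgebroid K H R α β)
    (C : ℕ) (p q : Fin C → H) (htw : IsTwistor D p q) :
    ∃ (e : ∀ n : ℕ, TP K H n)
      (Fs : ∀ n : ℕ, PH K H (alphaF D p q) (betaF D p q) n →ₗ[K]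
          PH K H (fun a => α a) (fun a => β a) n)
      (ΔF : H →ₗ[K] QT K H (alphaF D p q) (betaF D p q) 2)
      (ΔpF : ∀ n : ℕ, H →ₗ[K] QT K H (alphaF D p q) (betaF D p q) (n + 1))
      (insR : ∀ n : ℕ, H →ₗ[K]
          QT K H (fun a => α a) (fun a => β a) (n + 1) →ₗ[K]
          QT K H (fun a => α a) (fun a => β a) (n + 1))
      (insF : ∀ n : ℕ, H →ₗ[K]
          QT K H (alphaF D p q) (betaF D p q) (n + 1) →ₗ[K]
          QT K H (alphaF D p q) (betaF D p q) (n + 1)),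
      IsEChain D p q e ∧ IsFSharp D p q e Fs ∧
      -- `Δ_F(x) = (F♯)⁻¹(Δ(x) · F)`
      (∀ (x : H) (s : TP K H 2), qmk K H α β 2 s = D.Δ x →
        Fs 2 (ΔF x) = qmk K H α β 2 (s * (show TP K H 2 from ∑ c, p c ⊗ₜ[K] q c))) ∧
      -- `Δ_F^n` are the iterated coproducts of `Δ_F`
      IsIteratedOn (alphaF D p q) (betaF D p q) ΔF ΔpF ∧
      -- the insertion action of `H`
      (∀ (n : ℕ) (h : H) (s t : TP K H (n + 1)),
        qmk K H α β (n + 1) s = D.Δpow n h →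
        insR n h (qmk K H α β (n + 1) t) = qmk K H α β (n + 1) (s * t)) ∧
      -- the insertion action of `H_F`
      (∀ (n : ℕ) (h : H) (s t : TP K H (n + 1)),
        qtMk K H (alphaF D p q) (betaF D p q) (n + 1) s = ΔpF n h →
        insF n h (qtMk K H (alphaF D p q) (betaF D p q) (n + 1) t) =
          qtMk K H (alphaF D p q) (betaF D p q) (n + 1) (s * t)) ∧
      -- the main identity
      (∀ (n : ℕ) (h : H) (u : QT K H (alphaF D p q) (betaF D p q) (n + 1)),
        Fs (n + 1) (insF n h u) = insR n h (Fs (n + 1) u)) := by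
  choose ρ hρ using FSI.ins_exists D
  choose Φ hΦ using FSI.fs_exists D p q htw
  refine ⟨FSI.ee D p q, FSI.FsAll D p q Φ, FSI.Dp (n := 1) D p q (ρ 1) (Φ 1),
    fun n => FSI.Dp D p q (ρ n) (Φ n), fun n => (ρ n).toLinearMap,
    fun n => FSI.insF D p q (ρ n) (Φ n), FSI.echain D p q htw, ⟨fun a => rfl, fun n x => hΦ n _⟩,
    ?_, ⟨?_, rfl, ?_⟩, fun n => hρ n, ?_, ?_⟩
  · intro x s hs
    exact FSI.DF_clause D p q htw (ρ 1) (Φ 1) (hρ 1) (hΦ 1) x s hs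
  · intro x
    apply (Φ 0).injective
    exact FSI.dp_zero D p q (ρ 0) (Φ 0) (hρ 0) (hΦ 0) x
  · intro n x N uu vv hx s hs
    exact FSI.iter_succ D p q htw n (ρ 1) (Φ 1) (hρ 1) (hΦ 1) (ρ n) (Φ n) (hρ n) (hΦ n)
      (ρ (n+1)) (Φ (n+1)) (hρ (n+1)) (hΦ (n+1)) x N uu vv hx s hs
  · intro n h s t hs
    exact FSI.insF_clause D p q (ρ n) (Φ n) (hρ n) (hΦ n) h s t hs
  · intro n h u
    exact FSI.insF_Φ D p q (ρ n) (Φ n) h u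
end
end
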